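/- (Proposition 3.5) Assume 0<h<2 with 2/h∉ℤ, h small and L large; set λ=⌊2/h⌋+1. Let C∈𝒞 and let η be the trap that equals +1̲ inside the interior of a rectangle R_{ℓ,m} with 2≤ℓ≤m≤L−2 and equals the chessboard C outside. (i) If ℓ<λ then ℙ_η(τ_𝒞<τ_{+1̲})→1 as β→∞, and for every ε>0, ℙ_η( exp{2βh(ℓ−1)−βε} < τ_𝒞 < exp{2βh(ℓ−1)+βε} )→1. (ii) If ℓ≥λ then ℙ_η(τ_{+1̲}<τ_𝒞)→1, and for every ε>0, ℙ_η( exp{2β(2−h)−βε} < τ_{+1̲} < exp{2β(2−h)+βε} )→1. -/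

import Mathlib

open scoped BigOperators Classical
open Filter

namespace PCA

/-- Sites of the two-dimensional discrete torus of side `L`. -/
abbrev Site (L : ℕ) := ZMod L × ZMod L

/-- Spin configurations: `true` codes the spin `+1`, `false` codes `-1`. -/
abbrev Config (L : ℕ) := Site L → Bool

noncomputable section

/-- The real value of a spin. -/
def spin (b : Bool) : ℝ := if b then 1 else -1

def east (L : ℕ) : Site L := (1, 0)
def north (L : ℕ) : Site L := (0, 1)

variable {L : ℕ}

/-- `S_σ(x)`: the sum of the spins of the four nearest neighbours of `x`. -/
def nnS (σ : Config L) (x : Site L) : ℝ :=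
  spin (σ (x + east L)) + spin (σ (x - east L)) +
    spin (σ (x + north L)) + spin (σ (x - north L))

/-- Single-site heat-bath probability `p_x(a|σ)`. -/
def flipP (β h : ℝ) (σ : Config L) (x : Site L) (a : Bool) : ℝ :=
  1 / (1 + Real.exp (-2 * β * spin a * (nnS σ x + h)))

/-- The PCA transition matrix `P(σ,η) = ∏_x p_x(η(x)|σ)`. -/
def Pmat (β h : ℝ) [NeZero L] (σ η : Config L) : ℝ :=
  ∏ x : Site L, flipP β h σ x (η x)

/-- The four-body Hamiltonian `H_β`. -/
def Ham (β h : ℝ) [NeZero L] (σ : Config L) : ℝ :=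
  -(β * h) * ∑ x : Site L, spin (σ x)
    - ∑ x : Site L, Real.log (Real.cosh (β * (nnS σ x + h)))

/-- The zero-temperature energy `E`. -/
def En (h : ℝ) [NeZero L] (σ : Config L) : ℝ :=
  -h * ∑ x : Site L, spin (σ x) - ∑ x : Site L, |nnS σ x + h|

/-- The zero-temperature drift map `T`. -/
def T (h : ℝ) (σ : Config L) : Config L :=
  fun x => if 0 < nnS σ x + h then true else false

def plusC (L : ℕ) : Config L := fun _ => true
def minusC (L : ℕ) : Config L := fun _ => false

/-- The even chessboard `C_e(x) = (-1)^(x₁+x₂)` (`true` at even-parity sites). -/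
def chessE (L : ℕ) : Config L := fun x => decide ((x.1 + x.2).val % 2 = 0)
def chessO (L : ℕ) : Config L := fun x => !(chessE L x)
def chessSet (L : ℕ) : Set (Config L) := {chessE L, chessO L}

def IsChessCfg {L : ℕ} (C : Config L) : Prop := C = chessE L ∨ C = chessO L

/-- A trap: a stable configuration or an element of a stable pair. -/
def IsTrap (h : ℝ) (σ : Config L) : Prop := T h σ = σ ∨ T h (T h σ) = σ

/-- The trap `σ̂` reached by the downhill path started at `σ`. -/
def hatTrap (h : ℝ) (σ : Config L) : Config L :=
  (T h)^[sInf {n | IsTrap h ((T h)^[n] σ)}] σ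

/-- The basin of attraction `𝔅(ζ)` of a trap `ζ`. -/
def basin (h : ℝ) (ζ : Config L) : Set (Config L) := {σ | hatTrap h σ = ζ}

/-- The interior of a rectangle on the dual lattice: an `a × b` block of sites
with lower-left corner `c`. -/
def rect (c : Site L) (a b : ℕ) : Set (Site L) :=
  { y | ∃ i j : ℕ, i < a ∧ j < b ∧ y = c + ((i : ZMod L), (j : ZMod L)) }

/-- The configuration equal to `ζ` inside the given rectangle and to `bg` outside. -/
def rectCfg (bg ζ : Config L) (c : Site L) (a b : ℕ) : Config L :=
  fun x => if x ∈ rect c a b then ζ x else bg x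

/-- Differences between sites at euclidean distance at most `2` on the torus. -/
def closeDiff (d : Site L) : Prop :=
  ∃ u v : ℤ, u ^ 2 + v ^ 2 ≤ 4 ∧ d = ((u : ZMod L), (v : ZMod L))

/-- Two sets of sites are non-interacting iff all pairs of sites are at
euclidean distance `> 2` (equivalently `≥ √5`). -/
def NonInteracting (A B : Set (Site L)) : Prop :=
  ∀ x ∈ A, ∀ y ∈ B, ¬ closeDiff (y - x)

/-- Nearest-neighbour adjacency on the torus. -/
def Adj (x y : Site L) : Prop :=
  y = x + east L ∨ y = x - east L ∨ y = x + north L ∨ y = x - north L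

def stepSet : Set (ℤ × ℤ) := {(1, 0), (-1, 0), (0, 1), (0, -1)}

/-- `X` contains a nearest-neighbour loop winding around the torus
(a percolating, torus-wrapping, cluster is a cluster containing such a loop). -/
def Wrapping (X : Set (Site L)) : Prop :=
  ∃ (n : ℕ) (f : ℕ → Site L) (d : ℕ → ℤ × ℤ),
    0 < n ∧ f n = f 0 ∧ (∑ i ∈ Finset.range n, d i) ≠ 0 ∧
    ∀ i < n, d i ∈ stepSet ∧
      f (i + 1) = f i + (((d i).1 : ZMod L), ((d i).2 : ZMod L)) ∧ f i ∈ X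

/-- `σ` has a well defined sea of the homogeneous phase `α`. -/
def SeaHom (h : ℝ) (α σ : Config L) : Prop :=
  ∃ X : Set (Site L), Wrapping X ∧ (∀ x ∈ X, σ x = α x) ∧
    ∀ n : ℕ, 1 ≤ n → ∀ x ∈ X, (T h)^[n] σ x = α x

/-- `σ` has a well defined sea of the chessboard `C`. -/
def SeaChess (h : ℝ) (C σ : Config L) : Prop :=
  ∃ X : Set (Site L), Wrapping X ∧ (∀ x ∈ X, σ x = C x) ∧
    ∀ n : ℕ, 1 ≤ n → ∀ x ∈ X, (T h)^[2 * n] σ x = C x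

def SeaMinus (h : ℝ) (σ : Config L) : Prop := SeaHom h (minusC L) σ
def SeaPlus (h : ℝ) (σ : Config L) : Prop := SeaHom h (plusC L) σ
def SeaChessAny (h : ℝ) (σ : Config L) : Prop :=
  SeaChess h (chessE L) σ ∨ SeaChess h (chessO L) σ

/-- Communication height `H(σ,η) = H(σ) - log P(σ,η)`. -/
def commH (β h : ℝ) [NeZero L] (σ η : Config L) : ℝ :=
  Ham β h σ - Real.log (Pmat β h σ η)

/-- Minimal height (minmax) `Φ(σ,η)` over all paths from `σ` to `η`. -/
def Phi (β h : ℝ) [NeZero L] (σ η : Config L) : ℝ :=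
  sInf { v | ∃ (n : ℕ) (f : ℕ → Config L), 0 < n ∧ f 0 = σ ∧ f n = η ∧
    v = sSup { w | ∃ i < n, w = commH β h (f i) (f (i + 1)) } }

/-- The barrier `Υ(η) = min_{ζ ∉ 𝔅(η)} Φ(η,ζ)` to exit the basin of the trap `η`. -/
def Ups (β h : ℝ) [NeZero L] (η : Config L) : ℝ :=
  sInf { v | ∃ ζ : Config L, ζ ∉ basin h η ∧ v = Phi β h η ζ }

/-- Probability, starting from `σ0`, that the first visit to `E` happens
at time `n` and at a state of `F`. -/
def firstHitP (β h : ℝ) [NeZero L] (σ0 : Config L) (E F : Set (Config L)) (n : ℕ) : ℝ :=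
  ∑ f : Fin (n + 1) → Config L,
    if f 0 = σ0 ∧ (∀ i : Fin (n + 1), (i : ℕ) < n → f i ∉ E) ∧ f (Fin.last n) ∈ E ∩ F
    then ∏ i : Fin n, Pmat β h (f i.castSucc) (f i.succ) else 0

/-- `ℙ_{σ0}(τ_A < τ_B)`. -/
def probHitBefore (β h : ℝ) [NeZero L] (σ0 : Config L) (A B : Set (Config L)) : ℝ :=
  ∑' n : ℕ, firstHitP β h σ0 (A ∪ B) (A \ B) n

/-- `ℙ_{σ0}(τ_D ∈ I)` (for `τ_D < ∞`). -/
def probTauIn (β h : ℝ) [NeZero L] (σ0 : Config L) (D : Set (Config L)) (I : Set ℝ) : ℝ :=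
  ∑' n : ℕ, if (n : ℝ) ∈ I then firstHitP β h σ0 D Set.univ n else 0

/-- `ℙ_{σ0}(τ_D > t)` (including the event that `D` is never visited). -/
def probTauGT (β h : ℝ) [NeZero L] (σ0 : Config L) (D : Set (Config L)) (t : ℝ) : ℝ :=
  1 - probTauIn β h σ0 D (Set.Iic t)

/-- `ℙ_{σ0}(σ_{τ_E} ∈ F)`. -/
def probFirstHitIn (β h : ℝ) [NeZero L] (σ0 : Config L) (E F : Set (Config L)) : ℝ :=
  ∑' n : ℕ, firstHitP β h σ0 E F n

/-- The critical length `λ = ⌊2/h⌋ + 1`. -/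
def lam (h : ℝ) : ℕ := Nat.floor (2 / h) + 1

/-- The protocritical height `Γ = -2hλ² + 2λ(4+h) - 2h`. -/
def Gam (h : ℝ) : ℝ :=
  -2 * h * (lam h : ℝ) ^ 2 + 2 * (lam h : ℝ) * (4 + h) - 2 * h

/-- The geometric conditions of Proposition 3.3 (iii) for a trap in the sea of
minuses, with `s` chessboard rectangles (indices `< s`) and `k - s` plus
rectangles (indices `≥ s`). -/
def MinusMultiSpec (h : ℝ) (σ : Config L) (s : ℕ) {k : ℕ}
    (c : Fin k → Site L) (a b : Fin k → ℕ) : Prop :=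
  1 ≤ k ∧ s ≤ k ∧
  (∀ i, 2 ≤ min (a i) (b i) ∧ max (a i) (b i) ≤ L - 2) ∧
  (∀ i j, i ≠ j → Disjoint (rect (c i) (a i) (b i)) (rect (c j) (a j) (b j))) ∧
  (∀ j i : Fin k, (j : ℕ) < s → s ≤ (i : ℕ) →
    NonInteracting (rect (c j) (a j) (b j)) (rect (c i) (a i) (b i))) ∧
  (∀ i j : Fin k, s ≤ (i : ℕ) → s ≤ (j : ℕ) → i ≠ j →
    NonInteracting (rect (c i) (a i) (b i)) (rect (c j) (a j) (b j))) ∧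
  (∀ x, (∀ i, x ∉ rect (c i) (a i) (b i)) → σ x = false) ∧
  (∀ i : Fin k, s ≤ (i : ℕ) → ∀ x ∈ rect (c i) (a i) (b i), σ x = true) ∧
  ∃ Cp : Fin k → Config L,
    (∀ j : Fin k, (j : ℕ) < s → IsChessCfg (Cp j) ∧
      ∃ (k' : ℕ) (c' : Fin k' → Site L) (a' b' : Fin k' → ℕ),
        (∀ i, rect (c' i) (a' i) (b' i) ⊆ rect (c j) (a j) (b j)) ∧
        (∀ i i', i ≠ i' →
          NonInteracting (rect (c' i) (a' i) (b' i)) (rect (c' i') (a' i') (b' i'))) ∧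
        (∀ i, ∀ x ∈ rect (c' i) (a' i) (b' i), σ x = true) ∧
        (∀ x ∈ rect (c j) (a j) (b j),
          (∀ i, x ∉ rect (c' i) (a' i) (b' i)) → σ x = Cp j x)) ∧
    (∀ i j : Fin k, (i : ℕ) < s → (j : ℕ) < s → i ≠ j → Cp i = Cp j →
      NonInteracting (rect (c i) (a i) (b i)) (rect (c j) (a j) (b j)))

/-- `η ∈ 𝒪_{-1}` (a `(λ-1) × λ` chessboard droplet in the sea of minuses) and
`ζ ∈ π_{-1}(η)` is one of its protocritical droplets. -/
def ProtoRel (h : ℝ) (η ζ : Config L) : Prop :=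
  ∃ (c : Site L) (a b : ℕ) (C : Config L) (y z : Site L),
    IsChessCfg C ∧
    ((a = lam h - 1 ∧ b = lam h) ∨ (a = lam h ∧ b = lam h - 1)) ∧
    (∀ x ∈ rect c a b, η x = C x) ∧ (∀ x ∉ rect c a b, η x = false) ∧
    y ∉ rect c a b ∧ z ∈ rect c a b ∧ Adj y z ∧ C z = true ∧
    (∀ x ∈ rect c a b, ζ x = !(C x)) ∧ ζ y = true ∧
    (∀ x, x ∉ rect c a b → x ≠ y → ζ x = false)

/-- The set `𝒪_{-1}` of `(λ-1) × λ` chessboard droplets in the sea of minuses. -/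
def OSet (h : ℝ) (L : ℕ) : Set (Config L) :=
  { η | ∃ (c : Site L) (a b : ℕ) (C : Config L),
      IsChessCfg C ∧ ((a = lam h - 1 ∧ b = lam h) ∨ (a = lam h ∧ b = lam h - 1)) ∧
      (∀ x ∈ rect c a b, η x = C x) ∧ (∀ x ∉ rect c a b, η x = false) }

/-- The set `𝒫_{-1}` of protocritical droplets. -/
def ProtoSet (h : ℝ) (L : ℕ) : Set (Config L) := { ζ | ∃ η, ProtoRel h η ζ }

end

section Markov

variable {α : Type*} [Fintype α]

/-- A stochastic matrix on a finite set. -/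
structure IsStoch (K : α → α → ℝ) : Prop where
  nonneg : ∀ σ η, 0 ≤ K σ η
  sum_eq : ∀ σ, ∑ η, K σ η = 1

/-- `kop K D f n σ` is the expectation of `f (σ_n)` on the event that `D` is not visited up to
time `n`, for the chain with transition matrix `K` started at `σ`. -/
noncomputable def kop (K : α → α → ℝ) (D : Set α) (f : α → ℝ) : ℕ → α → ℝ
  | 0, σ => if σ ∈ D then 0 else f σ
  | n + 1, σ => if σ ∈ D then 0 else ∑ η, K σ η * kop K D f n η

/-- The probability that the chain started at `σ` does not visit `D` up to time `n`. -/
noncomputable def surv (K : α → α → ℝ) (D : Set α) (n : ℕ) (σ : α) : ℝ :=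
  kop K D (fun _ => 1) n σ

/-- The indicator function of a set, with real values. -/
noncomputable def ind (A : Set α) (σ : α) : ℝ := if σ ∈ A then 1 else 0

omit [Fintype α] in
lemma ind_nonneg (A : Set α) (σ : α) : 0 ≤ ind A σ := by
  unfold ind; split_ifs <;> norm_num

variable {K : α → α → ℝ} {D E A B : Set α} {f g : α → ℝ}

lemma IsStoch.le_one (hK : IsStoch K) (σ η : α) : K σ η ≤ 1 :=
  hK.sum_eq σ ▸ Finset.single_le_sum (fun ζ _ => hK.nonneg σ ζ) (Finset.mem_univ η)

lemma IsStoch.avg_mono (hK : IsStoch K) (h : ∀ η, f η ≤ g η) (σ : α) :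
    ∑ η, K σ η * f η ≤ ∑ η, K σ η * g η :=
  Finset.sum_le_sum fun η _ => mul_le_mul_of_nonneg_left (h η) (hK.nonneg σ η)

lemma IsStoch.avg_const (hK : IsStoch K) (c : ℝ) (σ : α) : ∑ η, K σ η * c = c := by
  rw [← Finset.sum_mul, hK.sum_eq, one_mul]

lemma kop_of_mem (n : ℕ) {σ : α} (h : σ ∈ D) : kop K D f n σ = 0 := by
  cases n <;> simp [kop, h]

lemma kop_zero_of_notMem {σ : α} (h : σ ∉ D) : kop K D f 0 σ = f σ := by
  simp [kop, h]

lemma kop_succ_of_notMem (n : ℕ) {σ : α} (h : σ ∉ D) :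
    kop K D f (n + 1) σ = ∑ η, K σ η * kop K D f n η := by
  simp [kop, h]

lemma kop_mono (hK : IsStoch K) (h : ∀ η, f η ≤ g η) (n : ℕ) (σ : α) :
    kop K D f n σ ≤ kop K D g n σ := by
  induction n generalizing σ with
  | zero => by_cases hσ : σ ∈ D <;> simp [kop, hσ, h σ]
  | succ n ih =>
    by_cases hσ : σ ∈ D
    · simp [kop, hσ]
    · rw [kop_succ_of_notMem n hσ, kop_succ_of_notMem n hσ]
      exact hK.avg_mono ih σ

lemma kop_nonneg (hK : IsStoch K) (h : ∀ η, 0 ≤ f η) (n : ℕ) (σ : α) :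
    0 ≤ kop K D f n σ := by
  induction n generalizing σ with
  | zero => by_cases hσ : σ ∈ D <;> simp [kop, hσ, h σ]
  | succ n ih =>
    by_cases hσ : σ ∈ D
    · simp [kop, hσ]
    · rw [kop_succ_of_notMem n hσ]
      exact Finset.sum_nonneg fun η _ => mul_nonneg (hK.nonneg σ η) (ih η)

lemma kop_add (n : ℕ) (σ : α) :
    kop K D (fun η => f η + g η) n σ = kop K D f n σ + kop K D g n σ := by
  induction n generalizing σ with
  | zero => by_cases hσ : σ ∈ D <;> simp [kop, hσ]
  | succ n ih =>
    by_cases hσ : σ ∈ D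
    · simp [kop, hσ]
    · simp only [kop_succ_of_notMem n hσ, ih, mul_add, Finset.sum_add_distrib]

lemma kop_mul_left (c : ℝ) (n : ℕ) (σ : α) :
    kop K D (fun η => c * f η) n σ = c * kop K D f n σ := by
  induction n generalizing σ with
  | zero => by_cases hσ : σ ∈ D <;> simp [kop, hσ]
  | succ n ih =>
    by_cases hσ : σ ∈ D
    · simp [kop, hσ]
    · simp only [kop_succ_of_notMem n hσ, ih, Finset.mul_sum]
      exact Finset.sum_congr rfl fun _ _ => by ring

lemma kop_anti_set (hK : IsStoch K) (hDE : D ⊆ E) (h : ∀ η, 0 ≤ f η) (n : ℕ) (σ : α) :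
    kop K E f n σ ≤ kop K D f n σ := by
  induction n generalizing σ with
  | zero =>
    by_cases hE : σ ∈ E
    · rw [kop_of_mem 0 hE]; exact kop_nonneg hK h 0 σ
    · rw [kop_zero_of_notMem hE, kop_zero_of_notMem fun hD => hE (hDE hD)]
  | succ n ih =>
    by_cases hE : σ ∈ E
    · rw [kop_of_mem _ hE]; exact kop_nonneg hK h _ σ
    · rw [kop_succ_of_notMem n hE, kop_succ_of_notMem n fun hD => hE (hDE hD)]
      exact hK.avg_mono ih σ

lemma kop_kop (n m : ℕ) (σ : α) :
    kop K D f (n + m) σ = kop K D (kop K D f m) n σ := by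
  induction n generalizing σ with
  | zero =>
    rw [zero_add]
    by_cases hσ : σ ∈ D
    · rw [kop_of_mem _ hσ, kop_of_mem _ hσ]
    · rw [kop_zero_of_notMem hσ]
  | succ n ih =>
    rw [Nat.succ_add]
    by_cases hσ : σ ∈ D
    · rw [kop_of_mem _ hσ, kop_of_mem _ hσ]
    · simp only [kop_succ_of_notMem _ hσ, ih]

lemma surv_nonneg (hK : IsStoch K) (n : ℕ) (σ : α) : 0 ≤ surv K D n σ :=
  kop_nonneg hK (fun _ => zero_le_one) n σ

lemma surv_of_mem (n : ℕ) {σ : α} (h : σ ∈ D) : surv K D n σ = 0 := kop_of_mem n h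

lemma surv_zero_of_notMem {σ : α} (h : σ ∉ D) : surv K D 0 σ = 1 := kop_zero_of_notMem h

lemma surv_succ_of_notMem (n : ℕ) {σ : α} (h : σ ∉ D) :
    surv K D (n + 1) σ = ∑ η, K σ η * surv K D n η := kop_succ_of_notMem n h

lemma surv_le_one (hK : IsStoch K) (n : ℕ) (σ : α) : surv K D n σ ≤ 1 := by
  induction n generalizing σ with
  | zero =>
    by_cases hσ : σ ∈ D
    · rw [surv_of_mem _ hσ]; exact zero_le_one
    · rw [surv_zero_of_notMem hσ]
  | succ n ih =>
    by_cases hσ : σ ∈ D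
    · rw [surv_of_mem _ hσ]; exact zero_le_one
    · rw [surv_succ_of_notMem n hσ]
      exact (hK.avg_mono ih σ).trans_eq (hK.avg_const 1 σ)

lemma surv_succ_le (hK : IsStoch K) (n : ℕ) (σ : α) : surv K D (n + 1) σ ≤ surv K D n σ := by
  induction n generalizing σ with
  | zero =>
    by_cases hσ : σ ∈ D
    · rw [surv_of_mem _ hσ, surv_of_mem _ hσ]
    · rw [surv_zero_of_notMem hσ]; exact surv_le_one hK _ σ
  | succ n ih =>
    by_cases hσ : σ ∈ D
    · rw [surv_of_mem _ hσ, surv_of_mem _ hσ]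
    · rw [surv_succ_of_notMem _ hσ, surv_succ_of_notMem _ hσ]
      exact hK.avg_mono ih σ

lemma surv_antitone (hK : IsStoch K) (σ : α) : Antitone fun n => surv K D n σ :=
  antitone_nat_of_succ_le fun n => surv_succ_le hK n σ

/-- Chaining of hitting times: after reaching `B`, the set `D` is reached quickly. -/
lemma surv_chain (hK : IsStoch K) {δ : ℝ} (hδ : 0 ≤ δ) {t : ℕ}
    (hB : ∀ σ ∈ B, surv K D t σ ≤ δ) (s : ℕ) (σ : α) :
    surv K D (s + t) σ ≤ surv K B s σ + δ := by
  induction s generalizing σ with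
  | zero =>
    by_cases hσ : σ ∈ B
    · rw [surv_of_mem _ hσ, zero_add, zero_add]; exact hB σ hσ
    · rw [surv_zero_of_notMem hσ]; linarith [surv_le_one hK (D := D) (0 + t) σ]
  | succ s ih =>
    by_cases hσ : σ ∈ B
    · rw [surv_of_mem _ hσ, zero_add]
      exact (surv_antitone hK σ (Nat.le_add_left t (s + 1))).trans (hB σ hσ)
    · by_cases hD : σ ∈ D
      · rw [surv_of_mem _ hD]; linarith [surv_nonneg hK (D := B) (s + 1) σ]
      · rw [Nat.succ_add, surv_succ_of_notMem _ hD, surv_succ_of_notMem _ hσ]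
        refine (hK.avg_mono ih σ).trans_eq ?_
        simp only [mul_add, Finset.sum_add_distrib, hK.avg_const]

/-- One step towards `D` through an intermediate set `A`. -/
lemma surv_succ_le_of_step (hK : IsStoch K) {q r : ℝ} (hr : 0 ≤ r) (hr1 : r ≤ 1) {n : ℕ} {σ : α}
    (hq : q ≤ ∑ η, K σ η * ind A η) (hA : ∀ η ∈ A, surv K D n η ≤ 1 - r) :
    surv K D (n + 1) σ ≤ 1 - q * r := by
  have hq1 : q ≤ 1 := hq.trans <| (hK.avg_mono (g := fun _ => 1)
    (fun η => by unfold ind; split_ifs <;> norm_num) σ).trans_eq (hK.avg_const 1 σ)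
  by_cases hσ : σ ∈ D
  · rw [surv_of_mem _ hσ]; nlinarith
  · rw [surv_succ_of_notMem n hσ]
    have h : ∀ η, surv K D n η ≤ 1 + (-r) * ind A η := fun η => by
      unfold ind
      split_ifs with hη
      · linarith [hA η hη]
      · linarith [surv_le_one hK (D := D) n η]
    refine (hK.avg_mono h σ).trans ?_
    simp only [mul_add, Finset.sum_add_distrib, hK.avg_const, mul_left_comm _ (-r),
      ← Finset.mul_sum]
    nlinarith

/-- Repeated attempts: from every state of `A`, the set `D` is reached within `N` steps with
probability at least `p`, and at each fixed time the chain is in `A` up to probability `δ`. -/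
lemma surv_attempts (hK : IsStoch K) {p δ : ℝ} (hp : 0 ≤ p) (hp1 : p ≤ 1) {N : ℕ}
    (hA : ∀ ξ ∈ A, surv K D N ξ ≤ 1 - p) (σ : α) (k : ℕ)
    (hδ : ∀ n ≤ k * N, kop K ∅ (ind Aᶜ) n σ ≤ δ) :
    surv K D (k * N) σ ≤ (1 - p) ^ k + δ := by
  have h0 : 0 ≤ δ := (kop_nonneg hK (ind_nonneg _) 0 σ).trans (hδ 0 (Nat.zero_le _))
  induction k with
  | zero => simpa using (surv_le_one hK (D := D) 0 σ).trans (by linarith)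
  | succ k ih =>
    have ih := ih fun n hn => hδ n (hn.trans (Nat.mul_le_mul_right N k.le_succ))
    have h1 : surv K D ((k + 1) * N) σ = kop K D (surv K D N) (k * N) σ := by
      rw [Nat.succ_mul]; exact kop_kop _ _ _
    have h2 : ∀ ξ, surv K D N ξ ≤ (1 - p) * 1 + p * ind Aᶜ ξ := fun ξ => by
      unfold ind
      split_ifs with hξ
      · linarith [surv_le_one hK (D := D) N ξ]
      · linarith [hA ξ (by simpa using hξ)]
    have h3 := kop_mono hK (D := D) h2 (k * N) σ
    rw [kop_add, kop_mul_left, kop_mul_left] at h3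
    have h4 := (kop_anti_set hK (Set.empty_subset D) (ind_nonneg Aᶜ) (k * N) σ).trans
      (hδ (k * N) (Nat.mul_le_mul_right N k.le_succ))
    have h5 : kop K D (fun _ => (1 : ℝ)) (k * N) σ ≤ (1 - p) ^ k + δ := ih
    rw [h1, pow_succ]
    nlinarith [mul_le_mul_of_nonneg_left h5 (by linarith : (0 : ℝ) ≤ 1 - p),
      mul_le_mul_of_nonneg_left h4 hp]

/-- If every state of `A` leaves `A` with probability at most `κ`, the exit time of `A` is
larger than `n` up to probability `n * κ`. -/
lemma le_surv_compl (hK : IsStoch K) {κ : ℝ} (hκ : 0 ≤ κ)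
    (hA : ∀ ξ ∈ A, ∑ η, K ξ η * ind Aᶜ η ≤ κ) (n : ℕ) (σ : α) :
    1 - n * κ - ind Aᶜ σ ≤ surv K Aᶜ n σ := by
  induction n generalizing σ with
  | zero =>
    unfold ind
    split_ifs with h
    · rw [surv_of_mem _ h]; simp
    · rw [surv_zero_of_notMem h]; simp
  | succ n ih =>
    by_cases h : σ ∈ Aᶜ
    · have : (0 : ℝ) ≤ (n + 1 : ℕ) * κ := by positivity
      rw [surv_of_mem _ h, ind, if_pos h]; linarith
    · rw [surv_succ_of_notMem n h]
      have h1 := hK.avg_mono ih σ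
      simp only [mul_sub, Finset.sum_sub_distrib, hK.avg_const] at h1
      have h2 := hA σ (by simpa using h)
      rw [ind, if_neg h]; push_cast
      linarith

lemma kop_empty_compl_le (hK : IsStoch K) (n : ℕ) (σ : α) :
    kop K ∅ (ind Aᶜ) n σ ≤ 1 - surv K Aᶜ n σ := by
  induction n generalizing σ with
  | zero =>
    rw [kop_zero_of_notMem (by simp)]
    unfold ind
    split_ifs with h
    · rw [surv_of_mem _ h]; simp
    · rw [surv_zero_of_notMem h]; simp
  | succ n ih =>
    rw [kop_succ_of_notMem _ (by simp)]
    have h1 := hK.avg_mono ih σ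
    simp only [mul_sub, Finset.sum_sub_distrib, hK.avg_const] at h1
    by_cases h : σ ∈ Aᶜ
    · rw [surv_of_mem _ h]
      have := Finset.sum_nonneg fun η (_ : η ∈ Finset.univ) =>
        mul_nonneg (hK.nonneg σ η) (surv_nonneg hK (D := Aᶜ) n η)
      linarith
    · rwa [surv_succ_of_notMem _ h]

lemma kop_empty_one (hK : IsStoch K) (c : ℝ) (n : ℕ) (σ : α) :
    kop K ∅ (fun _ => c) n σ = c := by
  induction n generalizing σ with
  | zero => rw [kop_zero_of_notMem (by simp)]
  | succ n ih => simp only [kop_succ_of_notMem _ (Set.notMem_empty σ), ih, hK.avg_const]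

section Stationary

variable {μ : α → ℝ}

lemma sum_mul_kop_empty (hμ : ∀ η, ∑ σ, μ σ * K σ η = μ η) (n : ℕ) :
    ∑ σ, μ σ * kop K ∅ f n σ = ∑ σ, μ σ * f σ := by
  induction n with
  | zero => simp only [kop_zero_of_notMem (Set.notMem_empty _)]
  | succ n ih =>
    simp only [kop_succ_of_notMem _ (Set.notMem_empty _), Finset.mul_sum]
    rw [Finset.sum_comm, ← ih]
    refine Finset.sum_congr rfl fun η _ => ?_
    simp only [← mul_assoc, ← Finset.sum_mul, hμ]

lemma mul_kop_empty_le (hK : IsStoch K) (hμ0 : ∀ σ, 0 ≤ μ σ)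
    (hμ : ∀ η, ∑ σ, μ σ * K σ η = μ η) (hf : ∀ σ, 0 ≤ f σ) (n : ℕ) (σ : α) :
    μ σ * kop K ∅ f n σ ≤ ∑ ξ, μ ξ * f ξ := by
  rw [← sum_mul_kop_empty hμ n]
  exact Finset.single_le_sum (f := fun σ => μ σ * kop K ∅ f n σ)
    (fun ξ _ => mul_nonneg (hμ0 ξ) (kop_nonneg hK hf n ξ)) (Finset.mem_univ σ)

lemma one_sub_surv_compl_le (hK : IsStoch K) (n : ℕ) (σ : α) :
    1 - surv K Aᶜ n σ ≤ ind Aᶜ σ +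
      ∑ k ∈ Finset.range n, kop K ∅ (fun ξ => ind A ξ * ∑ ζ, K ξ ζ * ind Aᶜ ζ) k σ := by
  have hφ : ∀ ξ, 0 ≤ ind A ξ * ∑ ζ, K ξ ζ * ind Aᶜ ζ := fun ξ =>
    mul_nonneg (ind_nonneg _ _) (Finset.sum_nonneg fun ζ _ =>
      mul_nonneg (hK.nonneg ξ ζ) (ind_nonneg _ _))
  induction n generalizing σ with
  | zero =>
    unfold ind
    split_ifs with h
    · rw [surv_of_mem _ h]; simp
    · rw [surv_zero_of_notMem h]; simp
  | succ n ih =>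
    by_cases h : σ ∈ Aᶜ
    · rw [surv_of_mem _ h, ind, if_pos h]
      linarith [Finset.sum_nonneg fun k (_ : k ∈ Finset.range (n + 1)) =>
        kop_nonneg hK (D := ∅) hφ k σ]
    · rw [surv_succ_of_notMem _ h, Finset.sum_range_succ', kop_zero_of_notMem (by simp)]
      have h1 := hK.avg_mono ih σ
      simp only [mul_sub, mul_add, Finset.sum_sub_distrib, Finset.sum_add_distrib, hK.avg_const,
        Finset.mul_sum] at h1
      rw [Finset.sum_comm (s := Finset.univ)] at h1
      simp only [kop_succ_of_notMem _ (Set.notMem_empty σ)]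
      have h2 : ind A σ = 1 := if_pos (by simpa using h)
      have h3 : ind Aᶜ σ = 0 := if_neg h
      rw [h2, h3]
      simp only [Finset.mul_sum, one_mul] at h1 ⊢
      linarith

/-- Exit estimate through a stationary measure. -/
lemma mul_one_sub_surv_compl_le (hK : IsStoch K) (hμ0 : ∀ σ, 0 ≤ μ σ)
    (hμ : ∀ η, ∑ σ, μ σ * K σ η = μ η) {σ : α} (hσ : σ ∈ A) {w : ℝ}
    (hw : ∀ ξ ∈ A, ∀ ζ ∉ A, μ ξ * K ξ ζ ≤ w) (hw0 : 0 ≤ w) (n : ℕ) :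
    μ σ * (1 - surv K Aᶜ n σ) ≤ n * ((Fintype.card α : ℝ) ^ 2 * w) := by
  have h1 := mul_le_mul_of_nonneg_left (one_sub_surv_compl_le hK (A := A) n σ) (hμ0 σ)
  have h3 : ind Aᶜ σ = 0 := if_neg (by simpa using hσ)
  rw [h3, zero_add, Finset.mul_sum] at h1
  refine h1.trans ?_
  rw [← nsmul_eq_mul]
  refine (Finset.sum_le_card_nsmul _ _ ((Fintype.card α : ℝ) ^ 2 * w) fun k _ => ?_).trans_eq
    (by rw [Finset.card_range])
  refine (mul_kop_empty_le hK hμ0 hμ (fun ξ => mul_nonneg (ind_nonneg _ _)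
    (Finset.sum_nonneg fun ζ _ => mul_nonneg (hK.nonneg ξ ζ) (ind_nonneg _ _))) k σ).trans ?_
  have h4 : ∀ ξ ∈ (Finset.univ : Finset α),
      μ ξ * (ind A ξ * ∑ ζ, K ξ ζ * ind Aᶜ ζ) ≤ Fintype.card α * w := fun ξ _ => by
    by_cases hξ : ξ ∈ A
    · rw [ind, if_pos hξ, one_mul, Finset.mul_sum, ← nsmul_eq_mul]
      refine Finset.sum_le_card_nsmul _ _ w fun ζ _ => ?_
      by_cases hζ : ζ ∈ A
      · rw [ind, if_neg (by simpa using hζ)]; simpa using hw0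
      · rw [ind, if_pos (by simpa using hζ), mul_one]; exact hw ξ hξ ζ hζ
    · rw [ind, if_neg hξ]; simp; positivity
  refine (Finset.sum_le_card_nsmul _ _ _ h4).trans_eq ?_
  rw [nsmul_eq_mul, Finset.card_univ]; ring

end Stationary

end Markov

section Local

variable {ι : Type*} [Fintype ι] [DecidableEq ι]

/-- The transition matrix of a parallel dynamics in which the site `x` is updated independently of
the others, with law `r σ x`. -/
noncomputable def prodK (r : (ι → Bool) → ι → Bool → ℝ) (σ η : ι → Bool) : ℝ := ∏ x, r σ x (η x)

/-- The single site laws of a parallel dynamics. -/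
structure IsRule (r : (ι → Bool) → ι → Bool → ℝ) : Prop where
  nonneg : ∀ σ x a, 0 ≤ r σ x a
  sum_eq : ∀ σ x, r σ x true + r σ x false = 1

variable {r r' : (ι → Bool) → ι → Bool → ℝ}

/-- The probability that all the updated spins satisfy prescribed constraints. -/
lemma sum_prodK_ite (r : (ι → Bool) → ι → Bool → ℝ) (σ : ι → Bool) (V : ι → Bool → Prop) :
    ∑ η, prodK r σ η * ind {η | ∀ x, V x (η x)} η =
      ∏ x, ((if V x true then r σ x true else 0) + (if V x false then r σ x false else 0)) := by
  have h := Finset.prod_univ_sum (fun _ : ι => (Finset.univ : Finset Bool))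
    (fun x a => if V x a then r σ x a else 0)
  simp only [Fintype.univ_bool, Finset.mem_singleton, Bool.true_eq_false,
    not_false_eq_true, Finset.sum_insert, Finset.sum_singleton] at h
  rw [h]
  refine Finset.sum_congr rfl fun η _ => ?_
  rw [Fintype.prod_ite_zero, ind]
  simp only [Set.mem_ofPred_eq, prodK, mul_ite, mul_one, mul_zero]

lemma IsRule.isStoch (hr : IsRule r) : IsStoch (prodK r) where
  nonneg σ η := Finset.prod_nonneg fun x _ => hr.nonneg σ x _
  sum_eq σ := by
    have h := sum_prodK_ite r σ fun _ _ => True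
    simpa [ind, hr.sum_eq] using h

/-- Lower bound for the probability of an event with at most one costly site. -/
lemma IsRule.le_sum_prodK (hr : IsRule r) {σ : ι → Bool} {V : ι → Bool → Prop} {A : Set (ι → Bool)}
    (hA : ∀ η, (∀ x, V x (η x)) → η ∈ A) {θ : ℝ} (hθ : 0 ≤ θ) (x₀ : ι)
    (hV : ∀ x, (if x = x₀ then θ else 1) / 2 ≤
      (if V x true then r σ x true else 0) + (if V x false then r σ x false else 0)) :
    (1 / 2) ^ Fintype.card ι * θ ≤ ∑ η, prodK r σ η * ind A η := by
  have h1 : ∑ η, prodK r σ η * ind {η | ∀ x, V x (η x)} η ≤ ∑ η, prodK r σ η * ind A η := by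
    refine hr.isStoch.avg_mono (fun η => ?_) σ
    unfold ind
    by_cases h : ∀ x, V x (η x)
    · rw [if_pos (by exact h), if_pos (hA η h)]
    · rw [if_neg (by exact h)]; split_ifs <;> norm_num
  refine le_trans ?_ h1
  rw [sum_prodK_ite]
  calc (1 / 2 : ℝ) ^ Fintype.card ι * θ = ∏ x : ι, (if x = x₀ then θ else 1) / 2 := by
        rw [Finset.prod_div_distrib, Finset.prod_ite_eq' Finset.univ x₀ fun _ => θ]
        simp [Finset.prod_const, Finset.card_univ]; ring
    _ ≤ _ := Finset.prod_le_prod (fun x _ => by split_ifs <;> linarith) fun x _ => hV x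

/-- Union bound for the probability of an event with rare local violations. -/
lemma IsRule.sum_prodK_compl_le (hr : IsRule r) {σ : ι → Bool} {V : ι → Bool → Prop}
    {A : Set (ι → Bool)} (hA : ∀ η, (∀ x, V x (η x)) → η ∈ A) {κ : ℝ}
    (hV : ∀ x a, ¬ V x a → r σ x a ≤ κ) (hκ : 0 ≤ κ) :
    ∑ η, prodK r σ η * ind Aᶜ η ≤ Fintype.card ι * (2 * κ) := by
  have h2 : ∀ x, ∑ η, prodK r σ η * ind {η | ¬ V x (η x)} η ≤ 2 * κ := fun x => by
    have h := sum_prodK_ite r σ fun y a => y = x → ¬ V x a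
    have hset : {η : ι → Bool | ∀ y, y = x → ¬ V x (η y)} = {η | ¬ V x (η x)} := by
      ext η; simp
    rw [hset] at h
    rw [h, Finset.prod_eq_single x]
    · by_cases h3 : V x true <;> by_cases h4 : V x false <;> simp only [h3, h4] <;> simp
      · exact hκ
      · linarith [hV x false h4]
      · linarith [hV x true h3]
      · linarith [hV x false h4, hV x true h3]
    · intro y _ hy
      simp [hy, hr.sum_eq]
    · simp
  have h1 : ∀ η, ind Aᶜ η ≤ ∑ x, ind {η : ι → Bool | ¬ V x (η x)} η := fun η => by
    by_cases h : ∀ x, V x (η x)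
    · rw [ind, if_neg (by simpa using hA η h)]
      exact Finset.sum_nonneg fun x _ => ind_nonneg _ _
    · push Not at h
      obtain ⟨x, hx⟩ := h
      have h3 : ind {η : ι → Bool | ¬ V x (η x)} η = 1 := if_pos hx
      have h4 : ind Aᶜ η ≤ 1 := by unfold ind; split_ifs <;> norm_num
      rw [← h3] at h4
      exact h4.trans (Finset.single_le_sum (f := fun x => ind {η : ι → Bool | ¬ V x (η x)} η)
        (fun x _ => ind_nonneg _ _) (Finset.mem_univ x))
  refine (hr.isStoch.avg_mono h1 σ).trans ?_
  simp only [Finset.mul_sum]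
  rw [Finset.sum_comm]
  refine (Finset.sum_le_card_nsmul _ _ (2 * κ) fun x _ => h2 x).trans_eq ?_
  rw [nsmul_eq_mul, Finset.card_univ]

/-- Stochastic domination of product laws. -/
lemma IsRule.sum_prodK_le (hr : IsRule r) (hr' : IsRule r') {σ' σ : ι → Bool}
    (h : ∀ x, r' σ' x true ≤ r σ x true) {f : (ι → Bool) → ℝ} (hf : Monotone f)
    (hf0 : ∀ η, 0 ≤ f η) :
    ∑ η, prodK r' σ' η * f η ≤ ∑ η, prodK r σ η * f η := by
  have := holley (μ := f) (f := prodK r' σ') (g := prodK r σ) hf0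
    (hr'.isStoch.nonneg σ') (hr.isStoch.nonneg σ) hf
    ((hr'.isStoch.sum_eq σ').trans (hr.isStoch.sum_eq σ).symm) ?_
  · simpa only [mul_comm] using this
  · intro a b
    simp only [prodK, ← Finset.prod_mul_distrib]
    refine Finset.prod_le_prod (fun x _ => mul_nonneg (hr'.nonneg _ _ _) (hr.nonneg _ _ _))
      fun x _ => ?_
    simp only [Pi.inf_apply, Pi.sup_apply]
    have h1 := hr.sum_eq σ x
    have h2 := hr'.sum_eq σ' x
    have h3 := h x
    have h4 := hr.nonneg σ x true
    have h5 := hr'.nonneg σ' x true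
    cases a x <;> cases b x <;> simp <;> nlinarith

/-- Comparison of two attractive dynamics. -/
lemma kop_prodK_le (hr : IsRule r) (hr' : IsRule r')
    (h : ∀ σ' σ : ι → Bool, σ' ≤ σ → ∀ x, r' σ' x true ≤ r σ x true)
    (hmono : ∀ σ' σ : ι → Bool, σ' ≤ σ → ∀ x, r σ' x true ≤ r σ x true)
    {D : Set (ι → Bool)} (hD : IsLowerSet D) {f : (ι → Bool) → ℝ} (hf : Monotone f)
    (hf0 : ∀ η, 0 ≤ f η) (n : ℕ) {σ' σ : ι → Bool} (hσ : σ' ≤ σ) :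
    kop (prodK r') D f n σ' ≤ kop (prodK r) D f n σ := by
  have hk : ∀ n, Monotone (kop (prodK r) D f n) := fun n => by
    induction n with
    | zero =>
      intro ξ ζ hξ
      by_cases h1 : ξ ∈ D
      · rw [kop_of_mem _ h1]; exact kop_nonneg hr.isStoch hf0 _ _
      · rw [kop_zero_of_notMem h1, kop_zero_of_notMem fun h2 => h1 (hD hξ h2)]; exact hf hξ
    | succ n ih =>
      intro ξ ζ hξ
      by_cases h1 : ξ ∈ D
      · rw [kop_of_mem _ h1]; exact kop_nonneg hr.isStoch hf0 _ _
      · rw [kop_succ_of_notMem _ h1, kop_succ_of_notMem _ fun h2 => h1 (hD hξ h2)]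
        exact hr.sum_prodK_le hr (hmono ξ ζ hξ) ih (kop_nonneg hr.isStoch hf0 n)
  refine le_trans ?_ (hk n hσ)
  clear hσ
  induction n generalizing σ' with
  | zero =>
    by_cases h1 : σ' ∈ D
    · rw [kop_of_mem _ h1, kop_of_mem _ h1]
    · rw [kop_zero_of_notMem h1, kop_zero_of_notMem h1]
  | succ n ih =>
    by_cases h1 : σ' ∈ D
    · rw [kop_of_mem _ h1, kop_of_mem _ h1]
    · rw [kop_succ_of_notMem _ h1, kop_succ_of_notMem _ h1]
      exact (hr'.isStoch.avg_mono (fun η => ih (σ' := η)) σ').trans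
        (hr.sum_prodK_le hr' (h σ' σ' le_rfl) (hk n) (kop_nonneg hr.isStoch hf0 n))

end Local

section Paths

variable {L : ℕ} [NeZero L] {β h : ℝ}

lemma firstHitP_zero (σ : Config L) (E F : Set (Config L)) :
    firstHitP β h σ E F 0 = ind (E ∩ F) σ := by
  unfold firstHitP ind
  rw [Fintype.sum_equiv (Equiv.funUnique (Fin 1) (Config L)) _
    (fun ξ => if ξ = σ ∧ ξ ∈ E ∩ F then (1 : ℝ) else 0)]
  · by_cases hσ : σ ∈ E ∩ F
    · rw [if_pos hσ, Finset.sum_eq_single σ] <;> simp_all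
    · rw [if_neg hσ]
      exact Finset.sum_eq_zero fun ξ _ => if_neg fun hξ : ξ = σ ∧ ξ ∈ E ∩ F => hσ (hξ.1 ▸ hξ.2)
  · intro f
    simp [Equiv.funUnique]

lemma firstHitP_succ (σ : Config L) (E F : Set (Config L)) (n : ℕ) :
    firstHitP β h σ E F (n + 1) =
      if σ ∈ E then 0 else ∑ η, Pmat β h σ η * firstHitP β h η E F n := by
  unfold firstHitP
  rw [← Fintype.sum_equiv (Fin.consEquiv fun _ : Fin (n + 2) => Config L) _ _ fun _ => rfl,
    Fintype.sum_prod_type, Finset.sum_eq_single σ]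
  · simp only [Fin.consEquiv_apply, Fin.cons_zero, true_and]
    by_cases hσ : σ ∈ E
    · rw [if_pos hσ]
      refine Finset.sum_eq_zero fun f _ => if_neg fun h => ?_
      exact h.1 0 (by simp) (by simpa using hσ)
    · rw [if_neg hσ]
      simp only [Finset.mul_sum]
      rw [Finset.sum_comm]
      refine Finset.sum_congr rfl fun f _ => ?_
      rw [Finset.sum_eq_single (f 0)]
      · have h1 : (∀ i : Fin (n + 2), (i : ℕ) < n + 1 →
            (Fin.cons σ f : Fin (n + 2) → Config L) i ∉ E) ↔
            ∀ i : Fin (n + 1), (i : ℕ) < n → f i ∉ E := by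
          rw [Fin.forall_fin_succ]
          simp [hσ]
        have h2 : (Fin.cons σ f : Fin (n + 2) → Config L) (Fin.last (n + 1)) = f (Fin.last n) := by
          rw [← Fin.succ_last, Fin.cons_succ]
        rw [mul_ite, mul_zero]
        refine if_congr (by rw [h1, h2]; simp) ?_ rfl
        rw [Fin.prod_univ_succ]
        simp only [Fin.castSucc_zero, Fin.cons_zero, Fin.cons_succ, ← Fin.succ_castSucc]
      · intro η _ hη
        rw [if_neg fun h => hη h.1.symm, mul_zero]
      · simp
  · intro ξ _ hξ
    refine Finset.sum_eq_zero fun f _ => if_neg fun h => hξ ?_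
    simpa using h.1
  · simp

lemma firstHitP_nonneg (hK : IsStoch (Pmat β h (L := L))) (σ : Config L) (E F : Set (Config L))
    (n : ℕ) : 0 ≤ firstHitP β h σ E F n := by
  induction n generalizing σ with
  | zero => rw [firstHitP_zero]; exact ind_nonneg _ _
  | succ n ih =>
    rw [firstHitP_succ]
    split_ifs
    · exact le_rfl
    · exact Finset.sum_nonneg fun η _ => mul_nonneg (hK.nonneg σ η) (ih η)

lemma sum_firstHitP_succ (σ : Config L) (E F : Set (Config L)) (n : ℕ) :
    ∑ k ∈ Finset.range (n + 1), firstHitP β h σ E F k = ind (E ∩ F) σ + if σ ∈ E then 0 else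
      ∑ η, Pmat β h σ η * ∑ k ∈ Finset.range n, firstHitP β h η E F k := by
  rw [Finset.sum_range_succ', firstHitP_zero, add_comm]
  congr 1
  simp only [firstHitP_succ]
  split_ifs
  · simp
  · rw [Finset.sum_comm]; simp only [Finset.mul_sum]

lemma sum_firstHitP_univ (hK : IsStoch (Pmat β h (L := L))) (σ : Config L) (E : Set (Config L))
    (n : ℕ) : ∑ k ∈ Finset.range (n + 1), firstHitP β h σ E Set.univ k =
      1 - surv (Pmat β h) E n σ := by
  induction n generalizing σ with
  | zero =>
    rw [Finset.sum_range_one, firstHitP_zero, Set.inter_univ, ind]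
    split_ifs with hσ
    · rw [surv_of_mem _ hσ, sub_zero]
    · rw [surv_zero_of_notMem hσ, sub_self]
  | succ n ih =>
    rw [sum_firstHitP_succ, Set.inter_univ, ind]
    split_ifs with hσ
    · rw [surv_of_mem _ hσ, sub_zero, add_zero]
    · rw [surv_succ_of_notMem _ hσ, zero_add]
      simp only [ih, mul_sub, Finset.sum_sub_distrib, hK.avg_const]

lemma sum_firstHitP_le_one (hK : IsStoch (Pmat β h (L := L))) (σ : Config L)
    (E F : Set (Config L)) (n : ℕ) :
    ∑ k ∈ Finset.range n, firstHitP β h σ E F k ≤ 1 := by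
  induction n generalizing σ with
  | zero => simp
  | succ n ih =>
    rw [sum_firstHitP_succ]
    by_cases hσ : σ ∈ E
    · rw [if_pos hσ, add_zero]; unfold ind; split_ifs <;> norm_num
    · rw [if_neg hσ, ind, if_neg fun h' => hσ h'.1, zero_add]
      exact (hK.avg_mono ih σ).trans_eq (hK.avg_const 1 σ)

lemma summable_firstHitP (hK : IsStoch (Pmat β h (L := L))) (σ : Config L)
    (E F : Set (Config L)) : Summable (firstHitP β h σ E F) :=
  summable_of_sum_range_le (firstHitP_nonneg hK σ E F) (sum_firstHitP_le_one hK σ E F)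

lemma probHitBefore_le_one (hK : IsStoch (Pmat β h (L := L))) (σ : Config L)
    (A B : Set (Config L)) : probHitBefore β h σ A B ≤ 1 :=
  Real.tsum_le_of_sum_range_le (firstHitP_nonneg hK σ _ _) (sum_firstHitP_le_one hK σ _ _)

/-- `ℙ(τ_A < τ_B) ≥ ℙ(τ_B > n) - ℙ(τ_A > n)`. -/
lemma le_probHitBefore (hK : IsStoch (Pmat β h (L := L))) (σ : Config L)
    (A B : Set (Config L)) (n : ℕ) :
    surv (Pmat β h) B n σ - surv (Pmat β h) A n σ ≤ probHitBefore β h σ A B := by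
  refine le_trans ?_ ((summable_firstHitP hK σ _ _).sum_le_tsum (Finset.range (n + 1))
    fun k _ => firstHitP_nonneg hK σ _ _ k)
  induction n generalizing σ with
  | zero =>
    rw [Finset.sum_range_one, firstHitP_zero, ind]
    by_cases hB : σ ∈ B
    · rw [surv_of_mem _ hB, if_neg fun h' => h'.2.2 hB]
      linarith [surv_nonneg hK (D := A) 0 σ]
    · by_cases hA : σ ∈ A
      · rw [if_pos ⟨Or.inl hA, hA, hB⟩, surv_of_mem _ hA]; linarith [surv_le_one hK (D := B) 0 σ]
      · rw [if_neg fun h' => hA h'.2.1, surv_zero_of_notMem hA, surv_zero_of_notMem hB, sub_self]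
  | succ n ih =>
    rw [sum_firstHitP_succ, ind]
    have hpos := Finset.sum_nonneg fun η (_ : η ∈ Finset.univ) => mul_nonneg (hK.nonneg σ η)
      (Finset.sum_nonneg fun k (_ : k ∈ Finset.range (n + 1)) =>
        firstHitP_nonneg hK η (A ∪ B) (A \ B) k)
    by_cases hB : σ ∈ B
    · rw [surv_of_mem _ hB, if_neg fun h' => h'.2.2 hB, if_pos (show σ ∈ A ∪ B from Or.inr hB)]
      linarith [surv_nonneg hK (D := A) (n + 1) σ]
    · by_cases hA : σ ∈ A
      · rw [if_pos ⟨Or.inl hA, hA, hB⟩, if_pos (show σ ∈ A ∪ B from Or.inl hA), surv_of_mem _ hA]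
        linarith [surv_le_one hK (D := B) (n + 1) σ]
      · rw [if_neg fun h' => hA h'.2.1, if_neg (by simp [hA, hB]), surv_succ_of_notMem _ hA,
          surv_succ_of_notMem _ hB, zero_add, ← Finset.sum_sub_distrib]
        simp only [← mul_sub]
        exact hK.avg_mono ih σ

lemma probTauIn_le_one (hK : IsStoch (Pmat β h (L := L))) (σ : Config L)
    (D : Set (Config L)) (I : Set ℝ) : probTauIn β h σ D I ≤ 1 := by
  refine Real.tsum_le_of_sum_range_le (fun k => ?_) fun k => ?_
  · split_ifs
    · exact firstHitP_nonneg hK σ _ _ k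
    · exact le_rfl
  · refine le_trans (Finset.sum_le_sum fun i _ => ?_) (sum_firstHitP_le_one hK σ D Set.univ k)
    split_ifs
    · exact le_rfl
    · exact firstHitP_nonneg hK σ _ _ i

/-- `ℙ(τ_D ∈ I) ≥ ℙ(τ_D > m) - ℙ(τ_D > n)` if `I` contains all the integers of `(m, n]`. -/
lemma le_probTauIn (hK : IsStoch (Pmat β h (L := L))) (σ : Config L)
    (D : Set (Config L)) (I : Set ℝ) (m n : ℕ) (hI : ∀ k : ℕ, m < k → k ≤ n → (k : ℝ) ∈ I) :
    surv (Pmat β h) D m σ - surv (Pmat β h) D n σ ≤ probTauIn β h σ D I := by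
  have hnn : ∀ k : ℕ, 0 ≤ if (k : ℝ) ∈ I then firstHitP β h σ D Set.univ k else 0 := fun k => by
    split_ifs
    · exact firstHitP_nonneg hK σ _ _ k
    · exact le_rfl
  have hs : Summable fun k : ℕ => if (k : ℝ) ∈ I then firstHitP β h σ D Set.univ k else 0 :=
    (summable_firstHitP hK σ D Set.univ).of_nonneg_of_le hnn fun k => by
      split_ifs
      · exact le_rfl
      · exact firstHitP_nonneg hK σ _ _ k
  refine le_trans ?_ (hs.sum_le_tsum (Finset.range (n + 1)) fun k _ => hnn k)
  rcases le_total n m with hmn | hmn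
  · exact (sub_nonpos.2 (surv_antitone hK σ hmn)).trans (Finset.sum_nonneg fun k _ => hnn k)
  · have h1 := sum_firstHitP_univ hK σ D n
    have h2 := sum_firstHitP_univ hK σ D m
    have h3 := Finset.sum_range_add_sum_Ico (fun k => firstHitP β h σ D Set.univ k)
      (Nat.succ_le_succ hmn)
    have h4 := Finset.sum_range_add_sum_Ico
      (fun k : ℕ => if (k : ℝ) ∈ I then firstHitP β h σ D Set.univ k else 0)
      (Nat.succ_le_succ hmn)
    have h5 : ∑ k ∈ Finset.Ico (m + 1) (n + 1),
        (if (k : ℝ) ∈ I then firstHitP β h σ D Set.univ k else 0) =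
        ∑ k ∈ Finset.Ico (m + 1) (n + 1), firstHitP β h σ D Set.univ k :=
      Finset.sum_congr rfl fun k hk => by
        rw [Finset.mem_Ico] at hk
        exact if_pos (hI k (by omega) (by omega))
    have h6 := Finset.sum_nonneg fun k (_ : k ∈ Finset.range (m + 1)) => hnn k
    simp only [Nat.succ_eq_add_one] at h3 h4
    linarith

end Paths

section SingleSite

variable {L : ℕ} {β h : ℝ}

@[simp] lemma spin_true : spin true = 1 := rfl

@[simp] lemma spin_false : spin false = -1 := rfl

lemma neg_one_le_spin (b : Bool) : -1 ≤ spin b := by cases b <;> norm_num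

lemma spin_le_one (b : Bool) : spin b ≤ 1 := by cases b <;> norm_num

lemma spin_mono {a b : Bool} (hab : a ≤ b) : spin a ≤ spin b := by
  revert hab; cases a <;> cases b <;> simp

lemma nnS_mono {σ σ' : Config L} (hσ : σ ≤ σ') (x : Site L) : nnS σ x ≤ nnS σ' x := by
  unfold nnS
  linarith [spin_mono (hσ (x + east L)), spin_mono (hσ (x - east L)),
    spin_mono (hσ (x + north L)), spin_mono (hσ (x - north L))]

lemma flipP_pos (σ : Config L) (x : Site L) (a : Bool) : 0 < flipP β h σ x a := by
  unfold flipP; positivity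

lemma flipP_true_add_false (σ : Config L) (x : Site L) :
    flipP β h σ x true + flipP β h σ x false = 1 := by
  unfold flipP
  have h1 : -2 * β * spin false * (nnS σ x + h) = -(-2 * β * spin true * (nnS σ x + h)) := by
    simp
  rw [h1, Real.exp_neg]
  have := Real.exp_pos (-2 * β * spin true * (nnS σ x + h))
  field_simp
  ring

lemma isRule_flipP (β h : ℝ) : IsRule (flipP (L := L) β h) :=
  ⟨fun σ x a => (flipP_pos σ x a).le, flipP_true_add_false⟩

lemma isStoch_Pmat [NeZero L] (β h : ℝ) : IsStoch (Pmat (L := L) β h) :=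
  (isRule_flipP β h).isStoch

lemma flipP_le_exp {σ : Config L} {x : Site L} {a : Bool} {u : ℝ}
    (hu : 2 * β * spin a * (nnS σ x + h) ≤ u) : flipP β h σ x a ≤ Real.exp u := by
  refine le_trans ?_ (Real.exp_le_exp.2 hu)
  unfold flipP
  rw [show -2 * β * spin a * (nnS σ x + h) = -(2 * β * spin a * (nnS σ x + h)) by ring,
    Real.exp_neg, div_le_iff₀ (by positivity)]
  have := Real.exp_pos (2 * β * spin a * (nnS σ x + h))
  field_simp
  linarith

lemma exp_half_le_flipP {σ : Config L} {x : Site L} {a : Bool} {u : ℝ} (hu0 : u ≤ 0)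
    (hu : u ≤ 2 * β * spin a * (nnS σ x + h)) : Real.exp u / 2 ≤ flipP β h σ x a := by
  unfold flipP
  have h1 : Real.exp (-2 * β * spin a * (nnS σ x + h)) ≤ Real.exp (-u) :=
    Real.exp_le_exp.2 (by linarith)
  rw [le_div_iff₀ (by positivity)]
  have h2 : Real.exp u * Real.exp (-u) = 1 := by rw [← Real.exp_add]; simp
  have h3 : Real.exp u ≤ 1 := Real.exp_le_one_iff.2 hu0
  nlinarith [Real.exp_pos u]

lemma half_le_flipP {σ : Config L} {x : Site L} {a : Bool}
    (hu : 0 ≤ 2 * β * spin a * (nnS σ x + h)) : 1 / 2 ≤ flipP β h σ x a := by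
  simpa using exp_half_le_flipP le_rfl hu

lemma flipP_true_mono (hβ : 0 ≤ β) {σ σ' : Config L} (hσ : σ ≤ σ') (x : Site L) :
    flipP β h σ x true ≤ flipP β h σ' x true := by
  unfold flipP
  have := nnS_mono hσ x
  refine one_div_le_one_div_of_le (by positivity) (add_le_add_right (Real.exp_le_exp.2 ?_) 1)
  simp only [spin_true]
  nlinarith

end SingleSite

section Geometry

variable {L : ℕ}

/-- The two lattice directions, in any order. -/
def IsFrame (e f : Site L) : Prop :=
  (e = east L ∧ f = north L) ∨ (e = north L ∧ f = east L)

/-- Lattice points in the coordinates with origin `c` and axes `e`, `f`. -/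
def pt (c e f : Site L) (i j : ℤ) : Site L := c + i • e + j • f

/-- The box with corner `c`, with `a` sites in the direction `e` and `b` in the direction `f`. -/
def gbox (c e f : Site L) (a b : ℕ) : Set (Site L) :=
  {y | ∃ i j : ℤ, 0 ≤ i ∧ i < a ∧ 0 ≤ j ∧ j < b ∧ y = pt c e f i j}

variable {c e f : Site L} {i j : ℤ} {a b : ℕ}

lemma pt_add_left : pt c e f i j + e = pt c e f (i + 1) j := by unfold pt; module

lemma pt_sub_left : pt c e f i j - e = pt c e f (i - 1) j := by unfold pt; module

lemma pt_add_right : pt c e f i j + f = pt c e f i (j + 1) := by unfold pt; module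

lemma pt_sub_right : pt c e f i j - f = pt c e f i (j - 1) := by unfold pt; module

lemma IsFrame.symm (hF : IsFrame e f) : IsFrame f e := by
  unfold IsFrame at *; tauto

lemma IsFrame.nnS_eq (hF : IsFrame e f) (σ : Config L) (x : Site L) :
    nnS σ x = spin (σ (x + e)) + spin (σ (x - e)) + spin (σ (x + f)) + spin (σ (x - f)) := by
  unfold nnS
  rcases hF with ⟨rfl, rfl⟩ | ⟨rfl, rfl⟩
  · rfl
  · ring

lemma IsFrame.pt_eq_iff (hF : IsFrame e f) {i' j' : ℤ} :
    pt c e f i j = pt c e f i' j' ↔ (L : ℤ) ∣ i - i' ∧ (L : ℤ) ∣ j - j' := by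
  simp only [← ZMod.intCast_zmod_eq_zero_iff_dvd]
  have h1 : ∀ u v : ℤ, u • east L + v • north L = ((u : ZMod L), (v : ZMod L)) := fun u v => by
    simp [east, north]
  have h2 : pt c e f i j = pt c e f i' j' ↔ (i - i') • e + (j - j') • f = 0 := by
    rw [← sub_eq_zero]
    have : pt c e f i j - pt c e f i' j' = (i - i') • e + (j - j') • f := by unfold pt; module
    rw [this]
  rw [h2]
  rcases hF with ⟨rfl, rfl⟩ | ⟨rfl, rfl⟩
  · rw [h1]; simp [Prod.ext_iff]
  · rw [add_comm, h1]; simp [Prod.ext_iff, and_comm]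

lemma IsFrame.exists_pt (hF : IsFrame e f) [NeZero L] (c x : Site L) :
    ∃ i j : ℤ, -1 ≤ i ∧ i ≤ L - 2 ∧ -1 ≤ j ∧ j ≤ L - 2 ∧ x = pt c e f i j := by
  have hL : (0 : ℤ) < L := by exact_mod_cast NeZero.pos L
  have key : ∀ z : ZMod L, ∃ i : ℤ, -1 ≤ i ∧ i ≤ L - 2 ∧ (i : ZMod L) = z := fun z => by
    refine ⟨((z + 1).val : ℤ) - 1, by omega, ?_, by simp⟩
    have := ZMod.val_lt (z + 1)
    omega
  obtain ⟨i, hi, hi', h1⟩ := key (x.1 - c.1)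
  obtain ⟨j, hj, hj', h2⟩ := key (x.2 - c.2)
  rcases hF with ⟨rfl, rfl⟩ | ⟨rfl, rfl⟩
  · refine ⟨i, j, hi, hi', hj, hj', Prod.ext ?_ ?_⟩ <;> simp [pt, east, north, h1, h2]
  · refine ⟨j, i, hj, hj', hi, hi', Prod.ext ?_ ?_⟩ <;> simp [pt, east, north, h1, h2]

lemma IsFrame.pt_mem_gbox (hF : IsFrame e f) (ha : a + 2 ≤ L) (hb : b + 2 ≤ L)
    (hi : -2 ≤ i) (hi' : i < L) (hj : -2 ≤ j) (hj' : j < L) :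
    pt c e f i j ∈ gbox c e f a b ↔ 0 ≤ i ∧ i < a ∧ 0 ≤ j ∧ j < b := by
  constructor
  · rintro ⟨u, v, hu, hu', hv, hv', huv⟩
    obtain ⟨⟨s, hs⟩, t, ht⟩ := hF.pt_eq_iff.1 huv
    have h1 : s = 0 := by
      have : s < 1 := by by_contra!; nlinarith
      have : -1 < s := by by_contra!; nlinarith
      omega
    have h2 : t = 0 := by
      have : t < 1 := by by_contra!; nlinarith
      have : -1 < t := by by_contra!; nlinarith
      omega
    subst h1 h2
    omega
  · rintro ⟨h1, h2, h3, h4⟩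
    exact ⟨i, j, h1, h2, h3, h4, rfl⟩

lemma rect_eq_gbox (c : Site L) (a b : ℕ) : rect c a b = gbox c (east L) (north L) a b := by
  have key : ∀ i j : ℤ, pt c (east L) (north L) i j = c + ((i : ZMod L), (j : ZMod L)) :=
    fun i j => by simp [pt, east, north, add_assoc]
  ext y
  constructor
  · rintro ⟨i, j, hi, hj, rfl⟩
    exact ⟨i, j, by omega, by omega, by omega, by omega, by simp [key]⟩
  · rintro ⟨i, j, hi, hi', hj, hj', rfl⟩
    lift i to ℕ using hi
    lift j to ℕ using hj
    exact ⟨i, j, by omega, by omega, by simp [key]⟩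

lemma gbox_symm (c e f : Site L) (a b : ℕ) : gbox c e f a b = gbox c f e b a := by
  have key : ∀ e f : Site L, ∀ i j : ℤ, pt c e f i j = pt c f e j i := fun e f i j => by
    unfold pt; module
  ext y
  constructor <;> rintro ⟨i, j, hi, hi', hj, hj', rfl⟩ <;>
    exact ⟨j, i, hj, hj', hi, hi', key _ _ i j⟩

lemma gbox_mono {a' b' : ℕ} (ha : a ≤ a') (hb : b ≤ b') : gbox c e f a b ⊆ gbox c e f a' b' := by
  rintro y ⟨i, j, hi, hi', hj, hj', rfl⟩
  exact ⟨i, j, hi, by omega, hj, by omega, rfl⟩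

lemma chessE_add [NeZero L] (hL : Even L) (hF : IsFrame e f) (x : Site L) :
    chessE L (x + e) = !chessE L x := by
  have hpar : ∀ z : ZMod L, decide ((z + 1).val % 2 = 0) = !decide (z.val % 2 = 0) := fun z => by
    obtain ⟨k, hk⟩ := hL
    have h0 := NeZero.pos L
    have : Fact (1 < L) := ⟨by omega⟩
    have hz := ZMod.val_lt z
    have := ZMod.val_add z 1
    rw [ZMod.val_one] at this
    rw [← decide_not, decide_eq_decide, this]
    rcases Nat.lt_or_ge (z.val + 1) L with h | h
    · rw [Nat.mod_eq_of_lt h]; omega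
    · rw [show z.val + 1 = L by omega, Nat.mod_self]; omega
  unfold chessE
  rw [← hpar]
  rcases hF with ⟨rfl, rfl⟩ | ⟨rfl, rfl⟩ <;> simp only [east, north, Prod.fst_add, Prod.snd_add] <;>
    congr 4 <;> ring

/-- The other chessboard. -/
def flipC (C : Config L) : Config L := fun x => !C x

lemma IsChessCfg.flipC {C : Config L} (hC : IsChessCfg C) : IsChessCfg (flipC C) := by
  rcases hC with rfl | rfl
  · exact Or.inr rfl
  · exact Or.inl (by funext x; simp [PCA.flipC, chessO])

lemma isChessCfg_iff {C : Config L} : IsChessCfg C ↔ C ∈ chessSet L := Iff.rfl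

/-- A chessboard alternates along the lattice directions. -/
lemma IsChessCfg.add [NeZero L] {C : Config L} (hC : IsChessCfg C) (hL : Even L) (hF : IsFrame e f)
    (x : Site L) : C (x + e) = !C x := by
  rcases hC with rfl | rfl
  · exact chessE_add hL hF x
  · simp only [chessO, chessE_add hL hF]

lemma IsChessCfg.sub [NeZero L] {C : Config L} (hC : IsChessCfg C) (hL : Even L) (hF : IsFrame e f)
    (x : Site L) : C (x - e) = !C x := by
  rw [← Bool.not_not (C (x - e)), ← hC.add hL hF (x - e), sub_add_cancel]

/-- A site whose neighbours outside of a box are all minus, with the site itself outside. -/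
lemma IsFrame.nnS_le_of_notMem_gbox [NeZero L] (hF : IsFrame e f) (ha : a + 2 ≤ L) (hb : b + 2 ≤ L)
    {σ : Config L} {x : Site L} (hx : x ∉ gbox c e f a b)
    (h1 : x + e ∉ gbox c e f a b → σ (x + e) = false)
    (h2 : x - e ∉ gbox c e f a b → σ (x - e) = false)
    (h3 : x + f ∉ gbox c e f a b → σ (x + f) = false)
    (h4 : x - f ∉ gbox c e f a b → σ (x - f) = false) : nnS σ x ≤ -2 := by
  obtain ⟨i, j, hi, hi', hj, hj', rfl⟩ := hF.exists_pt c x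
  rw [hF.pt_mem_gbox ha hb (by omega) (by omega) (by omega) (by omega)] at hx
  rw [hF.nnS_eq]
  rw [pt_add_left, hF.pt_mem_gbox ha hb (by omega) (by omega) (by omega) (by omega)] at *
  rw [pt_sub_left, hF.pt_mem_gbox ha hb (by omega) (by omega) (by omega) (by omega)] at *
  rw [pt_add_right, hF.pt_mem_gbox ha hb (by omega) (by omega) (by omega) (by omega)] at *
  rw [pt_sub_right, hF.pt_mem_gbox ha hb (by omega) (by omega) (by omega) (by omega)] at *
  have s1 := spin_le_one (σ (pt c e f (i + 1) j))
  have s2 := spin_le_one (σ (pt c e f (i - 1) j))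
  have s3 := spin_le_one (σ (pt c e f i (j + 1)))
  have s4 := spin_le_one (σ (pt c e f i (j - 1)))
  by_cases hj0 : 0 ≤ j ∧ j < b
  · rw [h3 (by omega), h4 (by omega)] at *
    by_cases hi0 : i < 0
    · rw [h2 (by omega)]; norm_num at *; linarith
    · rw [h1 (by omega)]; norm_num at *; linarith
  · rw [h1 (by omega), h2 (by omega)] at *
    by_cases hj1 : j < 0
    · rw [h4 (by omega)]; norm_num at *; linarith
    · rw [h3 (by omega)]; norm_num at *; linarith

end Geometry

section Steps

variable {α : Type*} [Fintype α] {K : α → α → ℝ}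

/-- A sequence of prescribed steps leading to `D`. -/
lemma surv_le_of_steps (hK : IsStoch K) {D : Set α} {H : ℕ → Set α} {q : ℕ → ℝ}
    (hq0 : ∀ s, 0 ≤ q s) (hq1 : ∀ s, q s ≤ 1) {N : ℕ}
    (hH : ∀ s < N, ∀ σ ∈ H s, q s ≤ ∑ η, K σ η * ind (H (s + 1)) η)
    (hD : H N ⊆ D) {σ : α} (hσ : σ ∈ H 0) :
    surv K D N σ ≤ 1 - ∏ s ∈ Finset.range N, q s := by
  induction N generalizing H q σ with
  | zero => simp [surv_of_mem 0 (hD hσ)]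
  | succ N ih =>
    rw [Finset.prod_range_succ', mul_comm]
    refine surv_succ_le_of_step hK (Finset.prod_nonneg fun s _ => hq0 _)
      (Finset.prod_le_one (fun s _ => hq0 _) fun s _ => hq1 _) (hH 0 (Nat.succ_pos _) σ hσ) ?_
    intro η hη
    exact ih (H := fun s => H (s + 1)) (q := fun s => q (s + 1)) (fun s => hq0 _)
      (fun s => hq1 _) (fun s hs => hH (s + 1) (by omega)) hD hη

end Steps

section OneStep

variable {L : ℕ} {β h g : ℝ} {σ : Config L} {x : Site L}

lemma half_le_flipP_true (hβ : 0 ≤ β) (hS : 0 ≤ nnS σ x + h) : 1 / 2 ≤ flipP β h σ x true := by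
  refine half_le_flipP ?_
  simp only [spin_true]; positivity

lemma half_le_flipP_false (hβ : 0 ≤ β) (hS : nnS σ x + h ≤ 0) :
    1 / 2 ≤ flipP β h σ x false := by
  refine half_le_flipP ?_
  simp only [spin_false]; nlinarith

lemma cost_le_flipP_true (hβ : 0 ≤ β) (hg : 0 ≤ g) (hS : -g ≤ nnS σ x + h) :
    Real.exp (-(2 * β * g)) / 2 ≤ flipP β h σ x true := by
  refine exp_half_le_flipP (by simp only [Left.neg_nonpos_iff]; positivity) ?_
  simp only [spin_true]; nlinarith

lemma cost_le_flipP_false (hβ : 0 ≤ β) (hg : 0 ≤ g) (hS : nnS σ x + h ≤ g) :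
    Real.exp (-(2 * β * g)) / 2 ≤ flipP β h σ x false := by
  refine exp_half_le_flipP (by simp only [Left.neg_nonpos_iff]; positivity) ?_
  simp only [spin_false]; nlinarith

lemma flipP_false_le (hβ : 0 ≤ β) (hS : g ≤ nnS σ x + h) :
    flipP β h σ x false ≤ Real.exp (-(2 * β * g)) := by
  refine flipP_le_exp ?_
  simp only [spin_false]; nlinarith

lemma flipP_true_le (hβ : 0 ≤ β) (hS : nnS σ x + h ≤ -g) :
    flipP β h σ x true ≤ Real.exp (-(2 * β * g)) := by
  refine flipP_le_exp ?_
  simp only [spin_true]; nlinarith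

/-- A site independent factor in the lower bounds for one-step probabilities. -/
noncomputable def cst (L : ℕ) [NeZero L] : ℝ := (1 / 2) ^ Fintype.card (Site L)

lemma cst_pos (L : ℕ) [NeZero L] : 0 < cst L := by unfold cst; positivity

lemma cst_le_one (L : ℕ) [NeZero L] : cst L ≤ 1 := pow_le_one₀ (by norm_num) (by norm_num)

lemma le_step [NeZero L] {V : Site L → Bool → Prop} {A : Set (Config L)}
    (hA : ∀ η, (∀ x, V x (η x)) → η ∈ A) {θ : ℝ} (hθ : 0 ≤ θ) (hθ1 : θ ≤ 1) (x₀ : Site L)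
    (hV : ∀ x, (∀ a, V x a) ∨ ∃ a, V x a ∧ (if x = x₀ then θ else 1) / 2 ≤ flipP β h σ x a) :
    cst L * θ ≤ ∑ η, Pmat β h σ η * ind A η := by
  refine (isRule_flipP β h).le_sum_prodK (σ := σ) (V := V) hA hθ x₀ fun x => ?_
  have h1 : (if x = x₀ then θ else 1) ≤ 1 := by split_ifs <;> linarith
  have ht := (flipP_pos (β := β) (h := h) σ x true).le
  have hf := (flipP_pos (β := β) (h := h) σ x false).le
  rcases hV x with hall | ⟨a, ha, hle⟩
  · rw [if_pos (hall _), if_pos (hall _), flipP_true_add_false]; linarith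
  · cases a
    · rw [if_pos ha]
      refine hle.trans (le_add_of_nonneg_left ?_)
      split_ifs <;> linarith
    · rw [if_pos ha]
      refine hle.trans (le_add_of_nonneg_right ?_)
      split_ifs <;> linarith

lemma step_compl_le [NeZero L] {V : Site L → Bool → Prop} {A : Set (Config L)}
    (hA : ∀ η, (∀ x, V x (η x)) → η ∈ A) {κ : ℝ} (hκ : 0 ≤ κ)
    (hV : ∀ x a, ¬ V x a → flipP β h σ x a ≤ κ) :
    ∑ η, Pmat β h σ η * ind Aᶜ η ≤ Fintype.card (Site L) * (2 * κ) :=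
  (isRule_flipP β h).sum_prodK_compl_le (σ := σ) hA hV hκ

end OneStep

section Confinement

variable {L : ℕ} [NeZero L] {β h : ℝ} {C σ : Config L} {R : Set (Site L)} {c e f : Site L}
  {a b : ℕ}

/-- The pluses of the chessboard `C` are present, and there are no other pluses outside of `R`. -/
structure Confined (R : Set (Site L)) (C σ : Config L) : Prop where
  chess : IsChessCfg C
  plus : ∀ x, C x = true → σ x = true
  minus : ∀ x, x ∉ R → C x = false → σ x = false

/-- The configurations which are confined to `R` up to a chessboard background. -/
def confSet (R : Set (Site L)) : Set (Config L) := {σ | ∃ C, Confined R C σ}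

lemma nnS_eq_four (hL : Even L) (hC : IsChessCfg C) (hp : ∀ x, C x = true → σ x = true)
    {x : Site L} (hx : C x = false) : nnS σ x = 4 := by
  have hE : IsFrame (east L) (north L) := Or.inl ⟨rfl, rfl⟩
  unfold nnS
  rw [hp _ (by rw [hC.add hL hE, hx]; rfl), hp _ (by rw [hC.sub hL hE, hx]; rfl),
    hp _ (by rw [hC.add hL hE.symm, hx]; rfl), hp _ (by rw [hC.sub hL hE.symm, hx]; rfl)]
  norm_num

lemma Confined.nnS_le (hσ : Confined (gbox c e f a b) C σ) (hL : Even L) (hF : IsFrame e f)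
    (ha : a + 2 ≤ L) (hb : b + 2 ≤ L) {x : Site L} (hx : C x = true)
    (hxR : x ∉ gbox c e f a b) : nnS σ x ≤ -2 :=
  hF.nnS_le_of_notMem_gbox ha hb hxR
    (fun hy => hσ.minus _ hy (by rw [hσ.chess.add hL hF, hx]; rfl))
    (fun hy => hσ.minus _ hy (by rw [hσ.chess.sub hL hF, hx]; rfl))
    (fun hy => hσ.minus _ hy (by rw [hσ.chess.add hL hF.symm, hx]; rfl))
    (fun hy => hσ.minus _ hy (by rw [hσ.chess.sub hL hF.symm, hx]; rfl))

lemma confSet_step_compl_le (hL : Even L) (hF : IsFrame e f) (ha : a + 2 ≤ L) (hb : b + 2 ≤ L)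
    (hβ : 0 ≤ β) (hh : 0 < h) (hσ : σ ∈ confSet (gbox c e f a b)) :
    ∑ η, Pmat β h σ η * ind (confSet (gbox c e f a b))ᶜ η ≤
      Fintype.card (Site L) * (2 * Real.exp (-(2 * β * (2 - h)))) := by
  obtain ⟨C, hσ⟩ := hσ
  refine step_compl_le (A := confSet (gbox c e f a b))
    (V := fun x t => (flipC C x = true → t = true) ∧
    (x ∉ gbox c e f a b → flipC C x = false → t = false))
    (fun η hη => ⟨flipC C, hσ.chess.flipC, fun x => (hη x).1, fun x => (hη x).2⟩)
    (Real.exp_pos _).le fun x t hV => ?_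
  cases hx : C x
  · cases t
    · refine flipP_false_le hβ ?_
      rw [nnS_eq_four hL hσ.chess hσ.plus hx]; linarith
    · simp [flipC, hx] at hV
  · cases t
    · simp [flipC, hx] at hV
    · refine flipP_true_le hβ ?_
      have := hσ.nnS_le hL hF ha hb hx fun hxR => hV (by simp [flipC, hx, hxR])
      linarith

/-- The chessboard below a configuration persists. -/
def aboveChess (L : ℕ) : Set (Config L) := {σ | ∃ C, IsChessCfg C ∧ ∀ x, C x = true → σ x = true}

lemma aboveChess_step_compl_le (hL : Even L) (hβ : 0 ≤ β) (hσ : σ ∈ aboveChess L) :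
    ∑ η, Pmat β h σ η * ind (aboveChess L)ᶜ η ≤
      Fintype.card (Site L) * (2 * Real.exp (-(2 * β * (4 + h)))) := by
  obtain ⟨C, hC, hσ⟩ := hσ
  refine step_compl_le (A := aboveChess L) (V := fun x t => flipC C x = true → t = true)
    (fun η hη => ⟨flipC C, hC.flipC, hη⟩) (Real.exp_pos _).le fun x t hV => ?_
  cases hx : C x
  · cases t
    · refine flipP_false_le hβ ?_
      rw [nnS_eq_four hL hC hσ hx]
    · simp at hV
  · simp [flipC, hx] at hV

lemma plusC_notMem_confSet (hL : Even L) (hF : IsFrame e f) (ha : a + 2 ≤ L) (hb : b + 2 ≤ L) :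
    plusC L ∉ confSet (gbox c e f a b) := by
  rintro ⟨C, hC⟩
  have hx : pt c e f a 0 ∉ gbox c e f a b := by
    rw [hF.pt_mem_gbox ha hb] <;> omega
  have hy : pt c e f a 0 + e ∉ gbox c e f a b := by
    rw [pt_add_left, hF.pt_mem_gbox ha hb] <;> omega
  cases h1 : C (pt c e f a 0)
  · simpa [plusC] using hC.minus _ hx h1
  · simpa [plusC] using hC.minus _ hy (by rw [hC.chess.add hL hF, h1]; rfl)

omit [NeZero L] in
lemma confSet_gbox_zero : confSet (gbox c e f a 0) ⊆ chessSet L := by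
  rintro σ ⟨C, hC⟩
  have : σ = C := by
    funext x
    cases hx : C x
    · exact hC.minus x (by rintro ⟨i, j, -, -, h1, h2, -⟩; simp at h2; omega) hx
    · exact hC.plus x hx
  exact this ▸ hC.chess

end Confinement

section Shrink

variable {L : ℕ} [NeZero L] {β h : ℝ} {C σ : Config L} {c e f : Site L} {a b : ℕ}

/-- The first `s` sites of the last row of the droplet have been removed. -/
def shrinkSet (c e f : Site L) (a b s : ℕ) : Set (Config L) :=
  {σ | ∃ C, Confined (gbox c e f a (b + 1)) C σ ∧ C (pt c e f s b) = true ∧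
    ∀ i : ℤ, 0 ≤ i → i < s → C (pt c e f i b) = false → σ (pt c e f i b) = false}

omit [NeZero L] in
lemma shrinkSet_last : shrinkSet c e f a b a ⊆ confSet (gbox c e f a b) := by
  rintro σ ⟨C, hC, -, hl⟩
  refine ⟨C, hC.chess, hC.plus, fun x hx hCx => ?_⟩
  by_cases hx' : x ∈ gbox c e f a (b + 1)
  · obtain ⟨i, j, hi, hi', hj, hj', rfl⟩ := hx'
    have : j = b := by
      by_contra hne
      exact hx ⟨i, j, hi, hi', hj, by push_cast at hj'; omega, rfl⟩
    subst this
    exact hl i hi hi' hCx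
  · exact hC.minus x hx' hCx

lemma shrinkSet_step (hL : Even L) (hF : IsFrame e f) (ha : a + 2 ≤ L) (hb : b + 3 ≤ L)
    (hβ : 0 ≤ β) (hh : 0 < h) (hh2 : h < 2) {s : ℕ} (hs : s < a) (hσ : σ ∈ shrinkSet c e f a b s) :
    cst L * (if s + 1 = a then 1 else Real.exp (-(2 * β * h))) ≤
      ∑ η, Pmat β h σ η * ind (shrinkSet c e f a b (s + 1)) η := by
  obtain ⟨C, hC, hs1, hl⟩ := hσ
  have hexp : Real.exp (-(2 * β * h)) ≤ 1 := Real.exp_le_one_iff.2 (by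
    simp only [Left.neg_nonpos_iff]; positivity)
  refine le_step (A := shrinkSet c e f a b (s + 1)) (x₀ := pt c e f s b)
    (V := fun x t => (flipC C x = true → t = true) ∧
    (x ∉ gbox c e f a (b + 1) → flipC C x = false → t = false) ∧
    ((∃ i : ℤ, 0 ≤ i ∧ i < s + 1 ∧ x = pt c e f i b) → flipC C x = false → t = false))
    (fun η hη => ⟨flipC C, ⟨hC.chess.flipC, fun x => (hη x).1, fun x => (hη x).2.1⟩, ?_, ?_⟩)
    (by split_ifs <;> positivity) (by split_ifs <;> simp [hexp]) fun x => ?_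
  · have := hC.chess.add hL hF (pt c e f s b)
    rw [pt_add_left, hs1] at this
    simp [flipC, this]
  · exact fun i hi hi' => (hη _).2.2 ⟨i, hi, by simpa using hi', rfl⟩
  cases hx : C x
  · refine Or.inr ⟨true, by simp [flipC, hx], le_trans ?_ (half_le_flipP_true hβ ?_)⟩
    · split_ifs <;> linarith
    · rw [nnS_eq_four hL hC.chess hC.plus hx]; linarith
  by_cases hxR : x ∉ gbox c e f a (b + 1)
  · refine Or.inr ⟨false, by simp [flipC, hx], le_trans ?_ (half_le_flipP_false hβ ?_)⟩
    · split_ifs <;> linarith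
    · have := hC.nnS_le hL hF ha hb hx hxR
      linarith
  by_cases hxi : ∃ i : ℤ, 0 ≤ i ∧ i < s + 1 ∧ x = pt c e f i b
  · refine Or.inr ⟨false, by simp [flipC, hx], ?_⟩
    obtain ⟨i, hi, hi', rfl⟩ := hxi
    have hS := hF.nnS_eq σ (pt c e f i b)
    have n1 := hC.chess.add hL hF (pt c e f i b)
    have n2 := hC.chess.sub hL hF (pt c e f i b)
    have n3 := hC.chess.add hL hF.symm (pt c e f i b)
    simp only [hx, Bool.not_true, pt_add_left, pt_sub_left, pt_add_right, pt_sub_right] at hS n1 n2 n3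
    have m2 : σ (pt c e f (i - 1) b) = false := by
      by_cases hi0 : i = 0
      · refine hC.minus _ ?_ n2
        rw [hF.pt_mem_gbox ha (by omega)] <;> omega
      · exact hl _ (by omega) (by omega) n2
    have m3 : σ (pt c e f i (b + 1)) = false := by
      refine hC.minus _ ?_ n3
      rw [hF.pt_mem_gbox ha (by omega)] <;> push_cast <;> omega
    have b1 := spin_le_one (σ (pt c e f (i + 1) b))
    have b4 := spin_le_one (σ (pt c e f i (b - 1)))
    have m1 : i ≠ s ∨ s + 1 = a → σ (pt c e f (i + 1) b) = false := by
      intro hcase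
      by_cases his : i = s
      · refine hC.minus _ ?_ n1
        rw [hF.pt_mem_gbox ha (by omega)] <;> omega
      · have : i + 1 ≠ s := by
          intro h1
          rw [h1, hs1] at n1
          simp at n1
        exact hl _ (by omega) (by omega) n1
    rw [m2, m3] at hS
    by_cases hcase : i ≠ s ∨ s + 1 = a
    · rw [m1 hcase] at hS
      refine le_trans ?_ (half_le_flipP_false hβ ?_)
      · split_ifs <;> linarith
      · norm_num at hS; linarith
    · push Not at hcase
      rw [if_pos (by rw [hcase.1]), if_neg hcase.2]
      refine cost_le_flipP_false hβ hh.le ?_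
      norm_num at hS; linarith
  · refine Or.inl fun t => ⟨by simp [flipC, hx], fun h' => absurd h' hxR, fun h' => absurd h' hxi⟩

lemma confSet_idle (hL : Even L) (hF : IsFrame e f) (ha : a + 2 ≤ L) (hb : b + 3 ≤ L)
    (hβ : 0 ≤ β) (hh : 0 < h) (hh2 : h < 2) (hC : Confined (gbox c e f a (b + 1)) C σ)
    (h0 : C (pt c e f 0 b) = false) :
    cst L ≤ ∑ η, Pmat β h σ η * ind (shrinkSet c e f a b 0) η := by
  rw [← mul_one (cst L)]
  refine le_step (A := shrinkSet c e f a b 0) (x₀ := c)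
    (V := fun x t => (flipC C x = true → t = true) ∧
    (x ∉ gbox c e f a (b + 1) → flipC C x = false → t = false))
    (fun η hη => ⟨flipC C, ⟨hC.chess.flipC, fun x => (hη x).1, fun x => (hη x).2⟩, ?_, ?_⟩)
    zero_le_one le_rfl fun x => ?_
  · simp [flipC, h0]
  · exact fun i hi hi' => absurd hi' (by simpa using hi)
  rw [ite_self]
  cases hx : C x
  · refine Or.inr ⟨true, by simp [flipC, hx], half_le_flipP_true hβ ?_⟩
    rw [nnS_eq_four hL hC.chess hC.plus hx]; linarith
  by_cases hxR : x ∉ gbox c e f a (b + 1)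
  · refine Or.inr ⟨false, by simp [flipC, hx], half_le_flipP_false hβ ?_⟩
    have := hC.nnS_le hL hF ha hb hx hxR
    linarith
  · exact Or.inl fun t => ⟨by simp [flipC, hx], fun h' => absurd h' hxR⟩

/-- A row of the droplet is removed with probability at least of order `exp (-2βh(a-1))`. -/
lemma surv_shrink (hL : Even L) (hF : IsFrame e f) (ha : a + 2 ≤ L) (ha1 : 1 ≤ a) (hb : b + 3 ≤ L)
    (hβ : 0 ≤ β) (hh : 0 < h) (hh2 : h < 2) (hσ : σ ∈ confSet (gbox c e f a (b + 1))) :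
    surv (Pmat β h) (confSet (gbox c e f a b)) (a + 1) σ ≤
      1 - cst L ^ (a + 1) * Real.exp (-(2 * β * h)) ^ (a - 1) := by
  have hK := isStoch_Pmat (L := L) β h
  have hexp : Real.exp (-(2 * β * h)) ≤ 1 := Real.exp_le_one_iff.2 (by
    simp only [Left.neg_nonpos_iff]; positivity)
  have hexp0 := Real.exp_pos (-(2 * β * h))
  set q : ℕ → ℝ := fun s => cst L * (if s + 1 = a then 1 else Real.exp (-(2 * β * h))) with hq
  have hq0 : ∀ s, 0 ≤ q s := fun s => mul_nonneg (cst_pos L).le (by split_ifs <;> positivity)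
  have hq1 : ∀ s, q s ≤ 1 := fun s => mul_le_one₀ (cst_le_one L) (by split_ifs <;> positivity)
    (by split_ifs <;> simp [hexp])
  have hprod : ∏ s ∈ Finset.range a, q s = cst L ^ a * Real.exp (-(2 * β * h)) ^ (a - 1) := by
    obtain ⟨k, rfl⟩ : ∃ k, a = k + 1 := ⟨a - 1, by omega⟩
    rw [Finset.prod_range_succ, Finset.prod_congr rfl (g := fun _ => cst L * Real.exp (-(2 * β * h)))]
    · simp only [hq, Finset.prod_const, Finset.card_range, Nat.add_sub_cancel]; simp; ring
    · intro s hs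
      rw [Finset.mem_range] at hs
      simp only [hq]; rw [if_neg (by omega)]
  have hP : 0 ≤ ∏ s ∈ Finset.range a, q s := Finset.prod_nonneg fun s _ => hq0 s
  have hP1 : ∏ s ∈ Finset.range a, q s ≤ 1 := Finset.prod_le_one (fun s _ => hq0 s) fun s _ => hq1 s
  have main : ∀ ξ ∈ shrinkSet c e f a b 0, surv (Pmat β h) (confSet (gbox c e f a b)) a ξ ≤
      1 - ∏ s ∈ Finset.range a, q s := fun ξ hξ =>
    surv_le_of_steps hK hq0 hq1
      (fun s hs ζ hζ => shrinkSet_step hL hF ha hb hβ hh hh2 hs hζ) shrinkSet_last hξ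
  have hfin : surv (Pmat β h) (confSet (gbox c e f a b)) (a + 1) σ ≤
      1 - cst L * ∏ s ∈ Finset.range a, q s := by
    obtain ⟨C, hC⟩ := hσ
    cases h0 : C (pt c e f 0 b)
    · exact surv_succ_le_of_step hK hP hP1 (confSet_idle hL hF ha hb hβ hh hh2 hC h0) main
    · refine (surv_succ_le hK a σ).trans ((main σ ⟨C, hC, h0, ?_⟩).trans ?_)
      · exact fun i hi hi' => absurd hi' (by simpa using hi)
      · nlinarith [cst_le_one L]
  rw [hprod] at hfin
  rw [pow_succ']
  linarith

end Shrink

section Growth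

variable {L : ℕ} {β h : ℝ} {C σ : Config L} {c e f : Site L} {ℓ : ℕ}
  {B : Finset (Site L)}

lemma IsFrame.nnS_nonneg_of_mem_gbox (hF : IsFrame e f) {a b : ℕ} (ha : 2 ≤ a) (hb : 2 ≤ b)
    (hσ : ∀ x ∈ gbox c e f a b, σ x = true) {x : Site L} (hx : x ∈ gbox c e f a b) :
    0 ≤ nnS σ x := by
  obtain ⟨i, j, hi, hi', hj, hj', rfl⟩ := hx
  rw [hF.nnS_eq, pt_add_left, pt_sub_left, pt_add_right, pt_sub_right]
  have s1 := neg_one_le_spin (σ (pt c e f (i + 1) j))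
  have s2 := neg_one_le_spin (σ (pt c e f (i - 1) j))
  have s3 := neg_one_le_spin (σ (pt c e f i (j + 1)))
  have s4 := neg_one_le_spin (σ (pt c e f i (j - 1)))
  have h1 : 0 ≤ spin (σ (pt c e f (i + 1) j)) + spin (σ (pt c e f (i - 1) j)) := by
    by_cases hi0 : i = 0
    · rw [hσ (pt c e f (i + 1) j) ⟨_, _, by omega, by omega, hj, hj', rfl⟩, spin_true]; linarith
    · rw [hσ (pt c e f (i - 1) j) ⟨_, _, by omega, by omega, hj, hj', rfl⟩, spin_true]; linarith
  have h2 : 0 ≤ spin (σ (pt c e f i (j + 1))) + spin (σ (pt c e f i (j - 1))) := by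
    by_cases hj0 : j = 0
    · rw [hσ (pt c e f i (j + 1)) ⟨_, _, hi, hi', by omega, by omega, rfl⟩, spin_true]; linarith
    · rw [hσ (pt c e f i (j - 1)) ⟨_, _, hi, hi', by omega, by omega, rfl⟩, spin_true]; linarith
  linarith

lemma IsFrame.gbox_square (hF : IsFrame e f) :
    gbox c e f ℓ ℓ = gbox c (east L) (north L) ℓ ℓ := by
  rcases hF with ⟨rfl, rfl⟩ | ⟨rfl, rfl⟩
  · rfl
  · exact gbox_symm ..

/-- The square with corner `c` and side `ℓ`. -/
def sq (ℓ : ℕ) (c : Site L) : Set (Site L) := gbox c (east L) (north L) ℓ ℓ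

/-- The configurations in which the squares with corners in `B` are filled, above a chessboard. -/
def filledSet (ℓ : ℕ) (B : Finset (Site L)) : Set (Config L) :=
  {σ | ∃ C, IsChessCfg C ∧ (∀ x, C x = true → σ x = true) ∧ ∀ y ∈ B, ∀ x ∈ sq ℓ y, σ x = true}

/-- The first `s` sites of a column adjacent to a square are filled. -/
def growSet (ℓ : ℕ) (B : Finset (Site L)) (c e f : Site L) (s : ℕ) : Set (Config L) :=
  {σ | ∃ C, IsChessCfg C ∧ (∀ x, C x = true → σ x = true) ∧ (∀ y ∈ B, ∀ x ∈ sq ℓ y, σ x = true) ∧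
    C (pt c e f ℓ s) = true ∧ ∀ j : ℤ, 0 ≤ j → j < s → σ (pt c e f ℓ j) = true}

lemma growSet_last (hF : IsFrame e f) (hc : c ∈ B) :
    growSet ℓ B c e f ℓ ⊆ filledSet ℓ (insert (c + e) B) := by
  rintro σ ⟨C, hC, hp, hB, -, hl⟩
  refine ⟨C, hC, hp, fun y hy x hx => ?_⟩
  rcases Finset.mem_insert.1 hy with rfl | hy
  · rw [sq, ← hF.gbox_square] at hx
    obtain ⟨i, j, hi, hi', hj, hj', rfl⟩ := hx
    have h1 : pt (c + e) e f i j = pt c e f (i + 1) j := by unfold pt; module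
    rw [h1]
    by_cases hil : i + 1 = ℓ
    · rw [hil]; exact hl j hj hj'
    · refine hB c hc _ ?_
      rw [sq, ← hF.gbox_square]
      exact ⟨i + 1, j, by omega, by omega, hj, hj', rfl⟩
  · exact hB y hy x hx

variable [NeZero L]

lemma growSet_step (hL : Even L) (hF : IsFrame e f) (hℓ : 2 ≤ ℓ)
    (hβ : 0 ≤ β) (hh : 0 < h) (hh2 : h < 2) (hc : c ∈ B) {s : ℕ} (hs : s < ℓ)
    (hσ : σ ∈ growSet ℓ B c e f s) :
    cst L * (if s = 0 then Real.exp (-(2 * β * (2 - h))) else 1) ≤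
      ∑ η, Pmat β h σ η * ind (growSet ℓ B c e f (s + 1)) η := by
  obtain ⟨C, hC, hp, hB, hs1, hl⟩ := hσ
  have hexp : Real.exp (-(2 * β * (2 - h))) ≤ 1 := Real.exp_le_one_iff.2 (by nlinarith)
  refine le_step (A := growSet ℓ B c e f (s + 1)) (x₀ := pt c e f ℓ s)
    (V := fun x t => (flipC C x = true → t = true) ∧ ((∃ y ∈ B, x ∈ sq ℓ y) → t = true) ∧
    ((∃ j : ℤ, 0 ≤ j ∧ j < s + 1 ∧ x = pt c e f ℓ j) → t = true))
    (fun η hη => ⟨flipC C, hC.flipC, fun x => (hη x).1, fun y hy x hx => (hη x).2.1 ⟨y, hy, hx⟩,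
      ?_, ?_⟩)
    (by split_ifs <;> positivity) (by split_ifs <;> simp [hexp]) fun x => ?_
  · have := hC.add hL hF.symm (pt c e f ℓ s)
    rw [pt_add_right, hs1] at this
    simp [flipC, this]
  · exact fun j hj hj' => (hη _).2.2 ⟨j, hj, by simpa using hj', rfl⟩
  have htriv : ∀ {x}, 0 ≤ nnS σ x + h →
      (if x = pt c e f ℓ s then if s = 0 then Real.exp (-(2 * β * (2 - h))) else 1 else 1) / 2 ≤
        flipP β h σ x true := fun hS =>
    le_trans (by split_ifs <;> linarith) (half_le_flipP_true hβ hS)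
  cases hx : C x
  · refine Or.inr ⟨true, by simp, htriv ?_⟩
    rw [nnS_eq_four hL hC hp hx]; linarith
  by_cases hxB : ∃ y ∈ B, x ∈ sq ℓ y
  · refine Or.inr ⟨true, by simp, htriv ?_⟩
    obtain ⟨y, hy, hxy⟩ := hxB
    have hE : IsFrame (east L) (north L) := Or.inl ⟨rfl, rfl⟩
    have := hE.nnS_nonneg_of_mem_gbox hℓ hℓ (hB y hy) hxy
    linarith
  by_cases hxj : ∃ j : ℤ, 0 ≤ j ∧ j < s + 1 ∧ x = pt c e f ℓ j
  · refine Or.inr ⟨true, by simp, ?_⟩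
    obtain ⟨j, hj, hj', rfl⟩ := hxj
    have hS := hF.nnS_eq σ (pt c e f ℓ j)
    simp only [pt_add_left, pt_sub_left, pt_add_right, pt_sub_right] at hS
    have m2 : σ (pt c e f (ℓ - 1) j) = true := by
      refine hB c hc _ ?_
      rw [sq, ← hF.gbox_square]
      exact ⟨ℓ - 1, j, by omega, by omega, hj, by omega, rfl⟩
    have b1 := neg_one_le_spin (σ (pt c e f (ℓ + 1) j))
    have b3 := neg_one_le_spin (σ (pt c e f ℓ (j + 1)))
    have b4 := neg_one_le_spin (σ (pt c e f ℓ (j - 1)))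
    rw [m2, spin_true] at hS
    by_cases hj0 : 0 < j
    · rw [hl (j - 1) (by omega) (by omega), spin_true] at hS
      exact htriv (by linarith)
    obtain rfl : j = 0 := by omega
    by_cases hs0 : s = 0
    · subst hs0
      rw [if_pos (by simp), if_pos rfl]
      refine cost_le_flipP_true hβ (by linarith) ?_
      linarith
    · by_cases hs2 : s = 1
      · subst hs2
        have := hC.add hL hF.symm (pt c e f ℓ 0)
        rw [pt_add_right, hx] at this
        simp only [Nat.cast_one] at hs1
        simp [hs1] at this
      · rw [hl (0 + 1) (by omega) (by omega), spin_true] at hS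
        exact htriv (by linarith)
  · exact Or.inl fun t => ⟨by simp [flipC, hx], fun h' => absurd h' hxB, fun h' => absurd h' hxj⟩

lemma filledSet_idle (hL : Even L) (hℓ : 2 ≤ ℓ)
    (hβ : 0 ≤ β) (hh : 0 < h) (hC : IsChessCfg C) (hp : ∀ x, C x = true → σ x = true)
    (hB : ∀ y ∈ B, ∀ x ∈ sq ℓ y, σ x = true) (h0 : C (pt c e f ℓ 0) = false) :
    cst L ≤ ∑ η, Pmat β h σ η * ind (growSet ℓ B c e f 0) η := by
  rw [← mul_one (cst L)]
  refine le_step (A := growSet ℓ B c e f 0) (x₀ := c)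
    (V := fun x t => (flipC C x = true → t = true) ∧ ((∃ y ∈ B, x ∈ sq ℓ y) → t = true))
    (fun η hη => ⟨flipC C, hC.flipC, fun x => (hη x).1, fun y hy x hx => (hη x).2 ⟨y, hy, hx⟩,
      ?_, ?_⟩)
    zero_le_one le_rfl fun x => ?_
  · simp [flipC, h0]
  · exact fun i hi hi' => absurd hi' (by simpa using hi)
  rw [ite_self]
  cases hx : C x
  · refine Or.inr ⟨true, by simp, half_le_flipP_true hβ ?_⟩
    rw [nnS_eq_four hL hC hp hx]; linarith
  by_cases hxB : ∃ y ∈ B, x ∈ sq ℓ y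
  · refine Or.inr ⟨true, by simp, half_le_flipP_true hβ ?_⟩
    obtain ⟨y, hy, hxy⟩ := hxB
    have hE : IsFrame (east L) (north L) := Or.inl ⟨rfl, rfl⟩
    have := hE.nnS_nonneg_of_mem_gbox hℓ hℓ (hB y hy) hxy
    linarith
  · exact Or.inl fun t => ⟨by simp [flipC, hx], fun h' => absurd h' hxB⟩

/-- A new square is filled with probability at least of order `exp (-2β(2-h))`. -/
lemma surv_grow (hL : Even L) (hF : IsFrame e f) (hℓ : 2 ≤ ℓ) (hβ : 0 ≤ β) (hh : 0 < h)
    (hh2 : h < 2) (hc : c ∈ B) (hσ : σ ∈ filledSet ℓ B) :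
    surv (Pmat β h) (filledSet ℓ (insert (c + e) B)) (ℓ + 1) σ ≤
      1 - cst L ^ (ℓ + 1) * Real.exp (-(2 * β * (2 - h))) := by
  have hK := isStoch_Pmat (L := L) β h
  have hexp : Real.exp (-(2 * β * (2 - h))) ≤ 1 := Real.exp_le_one_iff.2 (by nlinarith)
  have hexp0 := Real.exp_pos (-(2 * β * (2 - h)))
  set q : ℕ → ℝ := fun s => cst L * (if s = 0 then Real.exp (-(2 * β * (2 - h))) else 1) with hq
  have hq0 : ∀ s, 0 ≤ q s := fun s => mul_nonneg (cst_pos L).le (by split_ifs <;> positivity)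
  have hq1 : ∀ s, q s ≤ 1 := fun s => mul_le_one₀ (cst_le_one L) (by split_ifs <;> positivity)
    (by split_ifs <;> simp [hexp])
  have hprod : ∏ s ∈ Finset.range ℓ, q s = cst L ^ ℓ * Real.exp (-(2 * β * (2 - h))) := by
    obtain ⟨k, rfl⟩ : ∃ k, ℓ = k + 1 := ⟨ℓ - 1, by omega⟩
    rw [Finset.prod_range_succ', Finset.prod_congr rfl (g := fun _ => cst L)]
    · simp only [hq, Finset.prod_const, Finset.card_range]; simp; ring
    · intro s hs
      simp [hq]
  have hP : 0 ≤ ∏ s ∈ Finset.range ℓ, q s := Finset.prod_nonneg fun s _ => hq0 s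
  have hP1 : ∏ s ∈ Finset.range ℓ, q s ≤ 1 := Finset.prod_le_one (fun s _ => hq0 s) fun s _ => hq1 s
  have main : ∀ ξ ∈ growSet ℓ B c e f 0, surv (Pmat β h) (filledSet ℓ (insert (c + e) B)) ℓ ξ ≤
      1 - ∏ s ∈ Finset.range ℓ, q s := fun ξ hξ =>
    surv_le_of_steps hK hq0 hq1
      (fun s hs ζ hζ => growSet_step hL hF hℓ hβ hh hh2 hc hs hζ) (growSet_last hF hc) hξ
  have hfin : surv (Pmat β h) (filledSet ℓ (insert (c + e) B)) (ℓ + 1) σ ≤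
      1 - cst L * ∏ s ∈ Finset.range ℓ, q s := by
    obtain ⟨C, hC, hp, hB⟩ := hσ
    cases h0 : C (pt c e f ℓ 0)
    · exact surv_succ_le_of_step hK hP hP1 (filledSet_idle hL hℓ hβ hh hC hp hB h0) main
    · refine (surv_succ_le hK ℓ σ).trans ((main σ ⟨C, hC, hp, hB, h0, ?_⟩).trans ?_)
      · exact fun i hi hi' => absurd hi' (by simpa using hi)
      · nlinarith [cst_le_one L]
  rw [hprod] at hfin
  rw [pow_succ']
  linarith

lemma filledSet_univ (hℓ : 2 ≤ ℓ) :
    filledSet ℓ (Finset.univ : Finset (Site L)) ⊆ {plusC L} := by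
  rintro σ ⟨C, -, -, hB⟩
  refine funext fun x => hB x (Finset.mem_univ x) x ?_
  exact ⟨0, 0, le_rfl, by omega, le_rfl, by omega, by simp [pt]⟩

/-- A nonempty set of sites which is stable under the lattice translations is full. -/
lemma exists_add_notMem (hB : B.Nonempty) (hB' : B ≠ Finset.univ) :
    ∃ c ∈ B, ∃ e f, IsFrame e f ∧ c + e ∉ B := by
  by_contra! H
  obtain ⟨c, hc⟩ := hB
  have h1 : ∀ n : ℕ, ∀ y ∈ B, y + n • east L ∈ B := fun n => by
    induction n with
    | zero => simp
    | succ n ih =>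
      intro y hy
      rw [succ_nsmul, ← add_assoc]
      exact H _ (ih y hy) (east L) (north L) (Or.inl ⟨rfl, rfl⟩)
  have h2 : ∀ n : ℕ, ∀ y ∈ B, y + n • north L ∈ B := fun n => by
    induction n with
    | zero => simp
    | succ n ih =>
      intro y hy
      rw [succ_nsmul, ← add_assoc]
      exact H _ (ih y hy) (north L) (east L) (Or.inr ⟨rfl, rfl⟩)
  refine hB' (Finset.eq_univ_iff_forall.2 fun x => ?_)
  have := h2 (x - c).2.val _ (h1 (x - c).1.val c hc)
  convert this using 1
  ext <;> simp [east, north]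

end Growth

section BoxChain

variable {L : ℕ} {β h : ℝ} {Q : Set (Site L)} {σ η : Config L}

/-- The single-site law of the dynamics restricted to `Q`, with minus boundary conditions. -/
noncomputable def boxP (β h : ℝ) (Q : Set (Site L)) (σ : Config L) (x : Site L) (a : Bool) : ℝ :=
  if x ∈ Q then flipP β h σ x a else if a then 0 else 1

/-- The zero temperature dynamics restricted to `Q`. -/
noncomputable def boxT (h : ℝ) (Q : Set (Site L)) (σ : Config L) : Config L :=
  fun x => decide (x ∈ Q ∧ 0 < nnS σ x + h)

/-- The configuration filling `Q`. -/
noncomputable def fullC (Q : Set (Site L)) : Config L := fun x => decide (x ∈ Q)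

lemma isRule_boxP : IsRule (boxP (L := L) β h Q) where
  nonneg σ x a := by
    unfold boxP
    split_ifs <;> first | exact (flipP_pos σ x a).le | norm_num
  sum_eq σ x := by
    unfold boxP
    split_ifs <;> simp_all [flipP_true_add_false]

lemma boxP_true_le (hβ : 0 ≤ β) {σ' σ : Config L} (hσ : σ' ≤ σ) (x : Site L) :
    boxP β h Q σ' x true ≤ flipP β h σ x true := by
  unfold boxP
  by_cases hx : x ∈ Q
  · rw [if_pos hx]; exact flipP_true_mono hβ hσ x
  · rw [if_neg hx, if_pos rfl]; exact (flipP_pos σ x true).le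

lemma boxP_le_boxT (hβ : 0 ≤ β) (σ : Config L) (x : Site L) (a : Bool) :
    boxP β h Q σ x a ≤ boxP β h Q σ x (boxT h Q σ x) := by
  unfold boxP boxT
  by_cases hx : x ∈ Q
  · simp only [hx, if_true, true_and]
    unfold flipP
    refine one_div_le_one_div_of_le (by positivity) (add_le_add_right (Real.exp_le_exp.2 ?_) 1)
    by_cases hS : 0 < nnS σ x + h
    · rw [decide_eq_true hS, spin_true]
      nlinarith [spin_le_one a, mul_nonneg hβ (mul_nonneg (sub_nonneg.2 (spin_le_one a)) hS.le)]
    · rw [decide_eq_false hS, spin_false]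
      push Not at hS
      nlinarith [mul_nonneg hβ (mul_nonneg (neg_le_iff_add_nonneg.1 (neg_one_le_spin a))
        (neg_nonneg.2 hS))]
  · simp only [hx, if_false, false_and, decide_false]
    cases a <;> simp

lemma flipP_mul_eq (σ : Config L) (x : Site L) (a : Bool) :
    (Real.exp (β * (nnS σ x + h)) + Real.exp (-(β * (nnS σ x + h)))) * flipP β h σ x a =
      Real.exp (β * (spin a * (nnS σ x + h))) := by
  unfold flipP
  rw [mul_one_div, div_eq_iff (by positivity), mul_one_add, ← Real.exp_add]
  cases a
  · rw [add_comm]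
    simp only [spin_false]
    ring_nf
  · simp only [spin_true]
    ring_nf

variable [NeZero L]

/-- The exponent of the joint law of two successive configurations. -/
def pairW (h : ℝ) (σ η : Config L) : ℝ :=
  ∑ x, spin (η x) * (nnS σ x + h) + ∑ x, h * spin (σ x)

/-- The reversible weight of the dynamics restricted to `Q`. -/
noncomputable def boxMu (β h : ℝ) (Q : Set (Site L)) (σ : Config L) : ℝ :=
  if ∀ x ∉ Q, σ x = false then Real.exp (β * ∑ x, h * spin (σ x)) *
    ∏ x, (if x ∈ Q then Real.exp (β * (nnS σ x + h)) + Real.exp (-(β * (nnS σ x + h)))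
      else Real.exp (-(β * (nnS σ x + h)))) else 0

lemma boxMu_nonneg (σ : Config L) : 0 ≤ boxMu β h Q σ := by
  unfold boxMu
  split_ifs
  · refine mul_nonneg (Real.exp_pos _).le (Finset.prod_nonneg fun x _ => ?_)
    split_ifs <;> positivity
  · exact le_rfl

lemma boxMu_mul (σ η : Config L) :
    boxMu β h Q σ * prodK (boxP β h Q) σ η =
      if (∀ x ∉ Q, σ x = false) ∧ ∀ x ∉ Q, η x = false then Real.exp (β * pairW h σ η) else 0 := by
  unfold boxMu
  by_cases hσ : ∀ x ∉ Q, σ x = false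
  · rw [if_pos hσ, prodK, mul_assoc, ← Finset.prod_mul_distrib]
    by_cases hη : ∀ x ∉ Q, η x = false
    · have hexp : Real.exp (β * ∑ x, spin (η x) * (nnS σ x + h)) =
          ∏ x, Real.exp (β * (spin (η x) * (nnS σ x + h))) := by rw [Finset.mul_sum, Real.exp_sum]
      rw [if_pos ⟨hσ, hη⟩, pairW, mul_add, Real.exp_add, mul_comm, hexp]
      refine congrArg₂ _ (Finset.prod_congr rfl fun x _ => ?_) rfl
      unfold boxP
      by_cases hx : x ∈ Q
      · rw [if_pos hx, if_pos hx, flipP_mul_eq]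
      · rw [if_neg hx, if_neg hx, hη x hx]
        simp only [spin_false, Bool.false_eq_true, if_false]
        ring_nf
    · rw [if_neg fun h' => hη h'.2]
      push Not at hη
      obtain ⟨x, hx, hηx⟩ := hη
      refine mul_eq_zero_of_right _ (Finset.prod_eq_zero (Finset.mem_univ x) ?_)
      unfold boxP
      rw [if_neg hx, if_neg hx, if_pos (by simpa using hηx), mul_zero]
  · rw [if_neg hσ, if_neg fun h' => hσ h'.1, zero_mul]

lemma sum_spin_mul_shift (σ η : Config L) (e : Site L) :
    ∑ x, spin (η x) * spin (σ (x - e)) = ∑ x, spin (η (x + e)) * spin (σ x) := by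
  rw [← Equiv.sum_comp (Equiv.addRight e)]
  simp

/-- The number of disagreements, along the direction `e`, between successive configurations. -/
noncomputable def disagree (σ η : Config L) (e x : Site L) : ℝ :=
  (1 - spin (η (x + e)) * spin (σ x)) / 2 + (1 - spin (σ (x + e)) * spin (η x)) / 2

omit [NeZero L] in
lemma disagree_nonneg (σ η : Config L) (e x : Site L) : 0 ≤ disagree σ η e x := by
  unfold disagree
  cases σ x <;> cases η x <;> cases σ (x + e) <;> cases η (x + e) <;> norm_num

lemma pairW_eq {e f : Site L} (hF : IsFrame e f) (σ η : Config L) :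
    pairW h σ η = 4 * Fintype.card (Site L) - 2 * ∑ x, disagree σ η e x
      - 2 * ∑ x, disagree σ η f x + h * ∑ x, (spin (σ x) + spin (η x)) := by
  have key : ∀ e : Site L, ∑ x, spin (η x) * spin (σ (x + e)) +
      ∑ x, spin (η x) * spin (σ (x - e)) =
        2 * Fintype.card (Site L) - 2 * ∑ x, disagree σ η e x := fun e => by
    rw [sum_spin_mul_shift, ← Finset.sum_add_distrib, Finset.mul_sum,
      show (2 : ℝ) * Fintype.card (Site L) = ∑ _x : Site L, (2 : ℝ) by simp [mul_comm],
      ← Finset.sum_sub_distrib]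
    refine Finset.sum_congr rfl fun x _ => ?_
    unfold disagree
    ring
  have h1 := key e
  have h2 := key f
  have h3 : ∑ x, spin (η x) * (nnS σ x + h) =
      ∑ x, spin (η x) * spin (σ (x + e)) + ∑ x, spin (η x) * spin (σ (x - e)) +
      (∑ x, spin (η x) * spin (σ (x + f)) + ∑ x, spin (η x) * spin (σ (x - f))) +
      ∑ x, spin (η x) * h := by
    simp only [← Finset.sum_add_distrib, hF.nnS_eq]
    exact Finset.sum_congr rfl fun x _ => by ring
  rw [pairW, h3, h1, h2, Finset.sum_add_distrib, ← Finset.sum_mul, ← Finset.mul_sum]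
  ring

lemma pairW_symm (σ η : Config L) : pairW h σ η = pairW h η σ := by
  have hF : IsFrame (east L) (north L) := Or.inl ⟨rfl, rfl⟩
  have : ∀ e x, disagree σ η e x = disagree η σ e x := fun e x => by unfold disagree; ring
  simp only [pairW_eq hF, this, add_comm]

lemma boxMu_reversible (σ η : Config L) :
    boxMu β h Q σ * prodK (boxP β h Q) σ η = boxMu β h Q η * prodK (boxP β h Q) η σ := by
  simp only [boxMu_mul, pairW_symm σ η, and_comm]

lemma boxMu_stationary (η : Config L) :
    ∑ σ, boxMu β h Q σ * prodK (boxP β h Q) σ η = boxMu β h Q η := by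
  simp only [boxMu_reversible _ η]
  rw [← Finset.mul_sum, isRule_boxP.isStoch.sum_eq, mul_one]

end BoxChain

section Interpolation

variable {ι : Type*} [Fintype ι] [DecidableEq ι]

/-- Moving the spins one by one from `m` to `m'` one meets a boundary point of `P`. -/
lemma exists_interpolation {P : (ι → Bool) → Prop} {m m' : ι → Bool} (hm : P m) (hm' : ¬ P m') :
    ∃ m'', (∀ x, m'' x = m x ∨ m'' x = m' x) ∧ P m'' ∧ ∃ x v, ¬ P (Function.update m'' x v) := by
  have key : ∀ s : Finset ι, ¬ P (s.piecewise m' m) → ∃ m'', (∀ x, m'' x = m x ∨ m'' x = m' x) ∧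
      P m'' ∧ ∃ x v, ¬ P (Function.update m'' x v) := fun s => by
    induction s using Finset.induction with
    | empty => exact fun h => absurd (by simpa using hm) h
    | insert a s _ ih =>
      intro h
      by_cases hs : P (s.piecewise m' m)
      · refine ⟨_, fun x => ?_, hs, a, m' a, by rwa [← Finset.piecewise_insert]⟩
        by_cases hx : x ∈ s <;> simp [hx]
      · exact ih hs
  exact key Finset.univ (by simpa using hm')

/-- A word starting and ending with the same letter, and containing another one, changes twice. -/
lemma two_le_sum_changes (z : ℕ → Bool) {n k : ℕ} (hk : k ≤ n) (h0 : z 0 = false)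
    (hn : z n = false) (hz : z k = true) :
    2 ≤ ∑ i ∈ Finset.range n, (1 - spin (z (i + 1)) * spin (z i)) / 2 := by
  have key : ∀ a b : ℕ, a ≤ b → (1 - spin (z b) * spin (z a)) / 2 ≤
      ∑ i ∈ Finset.Ico a b, (1 - spin (z (i + 1)) * spin (z i)) / 2 := fun a b hab => by
    induction b, hab using Nat.le_induction with
    | base => cases z a <;> simp
    | succ b hab ih =>
      rw [Finset.sum_Ico_succ_top hab]
      revert ih
      generalize ∑ i ∈ Finset.Ico a b, (1 - spin (z (i + 1)) * spin (z i)) / 2 = t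
      cases z a <;> cases z b <;> cases z (b + 1) <;> norm_num <;> intro ih <;> linarith
  have h1 := key 0 k (Nat.zero_le k)
  have h2 := key k n hk
  rw [Finset.range_eq_Ico, ← Finset.sum_Ico_consecutive _ (Nat.zero_le k) hk]
  rw [h0, hz] at h1
  rw [hn, hz] at h2
  norm_num at h1 h2
  rw [Finset.range_eq_Ico] at h1
  linarith

end Interpolation

section Linked

variable {L : ℕ} {β h : ℝ} {σ η : Config L} {c e f : Site L} {ℓ : ℕ}

/-- The configurations seen alternately along a zigzag in space-time. -/
def zig (σ η : Config L) (i : ℕ) : Config L := if Even i then σ else η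

lemma zig_succ (σ η : Config L) (i : ℕ) : zig σ η (i + 1) = zig η σ i := by
  unfold zig
  by_cases hi : Even i <;> simp [hi, Nat.even_add_one]

/-- Every space-time zigzag crossing the square meets a plus. -/
def Linked (ℓ : ℕ) (c : Site L) (σ η : Config L) : Prop :=
  ∀ e f : Site L, IsFrame e f → ∀ j : ℕ, j < ℓ →
    (∃ i : ℕ, i < ℓ ∧ zig σ η i (pt c e f i j) = true) ∧
    ∃ i : ℕ, i < ℓ ∧ zig η σ i (pt c e f i j) = true

lemma Linked.symm (hl : Linked ℓ c σ η) : Linked ℓ c η σ :=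
  fun e f hF j hj => (hl e f hF j hj).symm

/-- All the pluses are in the set `Q`. -/
def SupportedOn (Q : Set (Site L)) (σ : Config L) : Prop := ∀ x ∉ Q, σ x = false

lemma SupportedOn.le_fullC {Q : Set (Site L)} (hσ : SupportedOn Q σ) : σ ≤ fullC Q := fun x => by
  by_cases hx : x ∈ Q
  · simp [fullC, hx, Bool.le_true]
  · simp [hσ x hx]

lemma supportedOn_fullC (Q : Set (Site L)) : SupportedOn Q (fullC Q) := fun x hx => by
  simp [fullC, hx]

lemma supportedOn_boxT (Q : Set (Site L)) (σ : Config L) : SupportedOn Q (boxT h Q σ) :=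
  fun x hx => by simp [boxT, hx]

lemma IsFrame.mem_sq (hF : IsFrame e f) (hℓ : ℓ + 2 ≤ L) {i j : ℤ}
    (hi : -2 ≤ i) (hi' : i < L) (hj : -2 ≤ j) (hj' : j < L) :
    pt c e f i j ∈ sq ℓ c ↔ 0 ≤ i ∧ i < ℓ ∧ 0 ≤ j ∧ j < ℓ := by
  rw [sq, ← hF.gbox_square, hF.pt_mem_gbox hℓ hℓ hi hi' hj hj']

variable [NeZero L]

lemma IsFrame.sum_pt_le (hF : IsFrame e f) {g : Site L → ℝ} (hg : ∀ x, 0 ≤ g x) (c : Site L)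
    {a b : ℕ} (ha : a ≤ L) (hb : b ≤ L) (u v : ℤ) :
    ∑ j ∈ Finset.range b, ∑ i ∈ Finset.range a, g (pt c e f (i + u) (j + v)) ≤ ∑ x, g x := by
  rw [← Finset.sum_product']
  have hinj : Set.InjOn (fun p : ℕ × ℕ => pt c e f (p.2 + u) (p.1 + v))
      (Finset.range b ×ˢ Finset.range a : Finset (ℕ × ℕ)) := by
    rintro ⟨j, i⟩ h1 ⟨j', i'⟩ h2 heq
    simp only [Finset.coe_product, Finset.coe_range, Set.mem_prod, Set.mem_Iio] at h1 h2
    obtain ⟨⟨s, hs⟩, t, ht⟩ := hF.pt_eq_iff.1 heq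
    simp only at hs ht
    have s0 : s = 0 := by
      have : s < 1 := by by_contra!; nlinarith
      have : -1 < s := by by_contra!; nlinarith
      omega
    have t0 : t = 0 := by
      have : t < 1 := by by_contra!; nlinarith
      have : -1 < t := by by_contra!; nlinarith
      omega
    subst s0 t0
    ext <;> simp only <;> omega
  rw [← Finset.sum_image (f := g) hinj]
  exact Finset.sum_le_univ_sum_of_nonneg hg

lemma Linked.le_sum_disagree (hl : Linked ℓ c σ η) (hF : IsFrame e f) (hℓ : ℓ + 2 ≤ L)
    (hσ : SupportedOn (sq ℓ c) σ) (hη : SupportedOn (sq ℓ c) η) :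
    4 * (ℓ : ℝ) ≤ ∑ x, disagree σ η e x := by
  refine le_trans ?_ (hF.sum_pt_le (disagree_nonneg σ η e) c (a := ℓ + 1) (b := ℓ)
    (by omega) (by omega) (-1) 0)
  have hrow : ∀ j ∈ Finset.range ℓ, (4 : ℝ) ≤
      ∑ i ∈ Finset.range (ℓ + 1), disagree σ η e (pt c e f (i + -1) (j + 0)) := fun j hj => by
    rw [Finset.mem_range] at hj
    have hout : ∀ i : ℤ, i = -1 ∨ i = ℓ → pt c e f i j ∉ sq ℓ c := fun i hi => by
      rw [hF.mem_sq hℓ] <;> omega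
    have hone : ∀ σ η : Config L, SupportedOn (sq ℓ c) σ → SupportedOn (sq ℓ c) η →
        (∃ i : ℕ, i < ℓ ∧ zig η σ i (pt c e f i j) = true) →
        2 ≤ ∑ i ∈ Finset.range (ℓ + 1),
          (1 - spin (zig σ η (i + 1) (pt c e f i j)) *
            spin (zig σ η i (pt c e f (i - 1) j))) / 2 := by
      rintro σ η hσ hη ⟨i, hi, hi1⟩
      have hz : ∀ k x, x ∉ sq ℓ c → zig σ η k x = false := fun k x hx => by
        unfold zig; split_ifs
        exacts [hσ x hx, hη x hx]
      have := two_le_sum_changes (fun k : ℕ => zig σ η k (pt c e f ((k : ℤ) - 1) j))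
        (n := ℓ + 1) (k := i + 1) (by omega) (hz _ _ (hout _ (by simp)))
        (hz _ _ (hout _ (by simp))) (by simpa [zig_succ] using hi1)
      simpa using this
    have h1 := hone σ η hσ hη (hl e f hF j hj).2
    have h2 := hone η σ hη hσ (hl e f hF j hj).1
    have h3 : ∑ i ∈ Finset.range (ℓ + 1), disagree σ η e (pt c e f (i + -1) (j + 0)) =
        ∑ i ∈ Finset.range (ℓ + 1), (1 - spin (zig σ η (i + 1) (pt c e f i j)) *
          spin (zig σ η i (pt c e f (i - 1) j))) / 2 +
        ∑ i ∈ Finset.range (ℓ + 1), (1 - spin (zig η σ (i + 1) (pt c e f i j)) *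
          spin (zig η σ i (pt c e f (i - 1) j))) / 2 := by
      rw [← Finset.sum_add_distrib]
      refine Finset.sum_congr rfl fun i _ => ?_
      rw [zig_succ, zig_succ, disagree, pt_add_left, add_zero, ← sub_eq_add_neg, sub_add_cancel]
      unfold zig
      split_ifs
      · rfl
      · rw [add_comm]
    linarith
  calc 4 * (ℓ : ℝ) = ∑ _j ∈ Finset.range ℓ, (4 : ℝ) := by simp [mul_comm]
    _ ≤ _ := Finset.sum_le_sum hrow

lemma sum_disagree_fullC_le (hF : IsFrame e f) (hℓ : ℓ + 2 ≤ L) :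
    ∑ x, disagree (fullC (sq ℓ c)) (fullC (sq ℓ c)) e x ≤ 4 * (ℓ : ℝ) := by
  set S : Finset (Site L) := (Finset.range ℓ).image (fun j : ℕ => pt c e f (-1) j) ∪
    (Finset.range ℓ).image (fun j : ℕ => pt c e f (ℓ - 1) j) with hS
  have hcard : S.card ≤ ℓ + ℓ := by
    refine (Finset.card_union_le _ _).trans (add_le_add ?_ ?_) <;>
      exact Finset.card_image_le.trans_eq (Finset.card_range ℓ)
  have hzero : ∀ x ∉ S, disagree (fullC (sq ℓ c)) (fullC (sq ℓ c)) e x = 0 := fun x hx => by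
    have hiff : x ∈ sq ℓ c ↔ x + e ∈ sq ℓ c := by
      by_contra hne
      refine hx ?_
      obtain ⟨i, j, hi, hi', hj, hj', rfl⟩ := hF.exists_pt c x
      rw [pt_add_left, hF.mem_sq hℓ, hF.mem_sq hℓ] at hne <;> try omega
      have hj0 : 0 ≤ j := by omega
      lift j to ℕ using hj0
      rw [hS, Finset.mem_union]
      by_cases hi1 : i = -1
      · exact Or.inl (Finset.mem_image.2 ⟨j, Finset.mem_range.2 (by omega), by rw [hi1]⟩)
      · exact Or.inr (Finset.mem_image.2 ⟨j, Finset.mem_range.2 (by omega), by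
          rw [show i = ℓ - 1 by omega]⟩)
    by_cases hxq : x ∈ sq ℓ c
    · simp [disagree, fullC, hxq, hiff.1 hxq]
    · have hxe : x + e ∉ sq ℓ c := fun h' => hxq (hiff.2 h')
      simp [disagree, fullC, hxq, hxe]
  rw [← Finset.sum_subset (Finset.subset_univ S) fun x _ hx => hzero x hx]
  have h2 : ∀ x ∈ S, disagree (fullC (sq ℓ c)) (fullC (sq ℓ c)) e x ≤ 2 := fun x _ => by
    unfold disagree
    generalize fullC (sq ℓ c) x = s
    generalize fullC (sq ℓ c) (x + e) = t
    cases s <;> cases t <;> norm_num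
  refine (Finset.sum_le_sum h2).trans ?_
  rw [Finset.sum_const, nsmul_eq_mul]
  have : (S.card : ℝ) ≤ ℓ + ℓ := by exact_mod_cast hcard
  linarith

/-- Twice the number of minuses in the square `Q`, in two successive configurations. -/
noncomputable def deficit (Q : Set (Site L)) (σ η : Config L) : ℝ :=
  ∑ x, ((spin (fullC Q x) - spin (σ x)) + (spin (fullC Q x) - spin (η x)))

lemma Linked.pairW_le (hl : Linked ℓ c σ η) (hℓ : ℓ + 2 ≤ L)
    (hσ : SupportedOn (sq ℓ c) σ) (hη : SupportedOn (sq ℓ c) η) :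
    pairW h σ η ≤ pairW h (fullC (sq ℓ c)) (fullC (sq ℓ c)) - h * deficit (sq ℓ c) σ η := by
  have hF : IsFrame (east L) (north L) := Or.inl ⟨rfl, rfl⟩
  rw [pairW_eq hF, pairW_eq hF]
  have h1 := hl.le_sum_disagree hF hℓ hσ hη
  have h2 := hl.le_sum_disagree hF.symm hℓ hσ hη
  have h3 := sum_disagree_fullC_le (c := c) hF hℓ
  have h4 := sum_disagree_fullC_le (c := c) hF.symm hℓ
  have h5 : deficit (sq ℓ c) σ η = ∑ x, (spin (fullC (sq ℓ c) x) + spin (fullC (sq ℓ c) x)) -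
      ∑ x, (spin (σ x) + spin (η x)) := by
    rw [deficit, ← Finset.sum_sub_distrib]
    exact Finset.sum_congr rfl fun x _ => by ring
  rw [h5]
  linarith

omit [NeZero L] in
lemma SupportedOn.deficit_term_nonneg {Q : Set (Site L)} (hσ : SupportedOn Q σ)
    (hη : SupportedOn Q η) (x : Site L) :
    0 ≤ (spin (fullC Q x) - spin (σ x)) + (spin (fullC Q x) - spin (η x)) := by
  linarith [spin_mono (hσ.le_fullC x), spin_mono (hη.le_fullC x)]

lemma two_le_deficit {Q : Set (Site L)} (hσ : SupportedOn Q σ) (hη : SupportedOn Q η)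
    (hne : σ ≠ fullC Q) : 2 ≤ deficit Q σ η := by
  obtain ⟨x, hx⟩ := Function.ne_iff.1 hne
  refine le_trans ?_ (Finset.single_le_sum (fun y _ => hσ.deficit_term_nonneg hη y)
    (Finset.mem_univ x))
  have h1 := spin_mono (hη.le_fullC x)
  have h2 := hσ.le_fullC x
  revert hx h1 h2
  cases σ x <;> cases fullC Q x <;> simp only [spin_true, spin_false, ne_eq, not_true_eq_false,
    false_implies, Bool.false_eq_true, reduceCtorEq, not_false_eq_true, true_implies]
  · intro h1 _; linarith
  · intro _ h2; exact absurd h2 (by simp)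

/-- A pair from which a single spin flip breaks the links has a large deficit. -/
lemma le_deficit_of_not_linked (hℓ : ℓ + 2 ≤ L) (hσ : SupportedOn (sq ℓ c) σ)
    (hη : SupportedOn (sq ℓ c) η) {x : Site L} {v : Bool}
    (hl : ¬ Linked ℓ c σ (Function.update η x v)) :
    2 * ((ℓ : ℝ) - 1) ≤ deficit (sq ℓ c) σ η := by
  obtain ⟨e, f, hF, j, hj, hrow⟩ : ∃ e f : Site L, IsFrame e f ∧ ∃ j : ℕ, j < ℓ ∧
      ∀ i : ℕ, i < ℓ → σ (pt c e f i j) = false ∨ Function.update η x v (pt c e f i j) = false := by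
    unfold Linked at hl
    push Not at hl
    obtain ⟨e, f, hF, j, hj, hl⟩ := hl
    refine ⟨e, f, hF, j, hj, fun i hi => ?_⟩
    by_cases h1 : ∃ i : ℕ, i < ℓ ∧ zig σ (Function.update η x v) i (pt c e f i j) = true
    · have := hl h1 i hi
      unfold zig at this
      split_ifs at this
      · exact Or.inr (by simpa using this)
      · exact Or.inl (by simpa using this)
    · push Not at h1
      have := h1 i hi
      unfold zig at this
      split_ifs at this
      · exact Or.inl (by simpa using this)
      · exact Or.inr (by simpa using this)
  refine le_trans ?_ (hF.sum_pt_le (hσ.deficit_term_nonneg hη) c (a := ℓ) (b := 1) (by omega)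
    (by omega) 0 j)
  rw [Finset.sum_range_one]
  have hterm : ∀ i ∈ Finset.range ℓ, 2 - (if pt c e f i j = x then (2 : ℝ) else 0) ≤
      (spin (fullC (sq ℓ c) (pt c e f (i + 0) ((0 : ℕ) + j))) -
        spin (σ (pt c e f (i + 0) ((0 : ℕ) + j)))) +
      (spin (fullC (sq ℓ c) (pt c e f (i + 0) ((0 : ℕ) + j))) -
        spin (η (pt c e f (i + 0) ((0 : ℕ) + j)))) := fun i hi => by
    rw [Finset.mem_range] at hi
    have hnn := hσ.deficit_term_nonneg hη (pt c e f i j)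
    simp only [add_zero, Nat.cast_zero, zero_add]
    split_ifs with hx
    · rw [sub_self]; exact hnn
    · have hmem : pt c e f i j ∈ sq ℓ c := by rw [hF.mem_sq hℓ] <;> omega
      have hfull : fullC (sq ℓ c) (pt c e f i j) = true := by simp [fullC, hmem]
      have h1 := spin_le_one (σ (pt c e f i j))
      have h2 := spin_le_one (η (pt c e f i j))
      rw [hfull, spin_true, sub_zero]
      have := hrow i hi
      rw [Function.update_of_ne hx] at this
      rcases this with h0 | h0 <;> rw [h0, spin_false] <;> linarith
  refine le_trans ?_ (Finset.sum_le_sum hterm)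
  rw [Finset.sum_sub_distrib, Finset.sum_ite, Finset.sum_const_zero, add_zero, Finset.sum_const,
    Finset.sum_const, Finset.card_range, nsmul_eq_mul, nsmul_eq_mul]
  have hc1 : ((Finset.range ℓ).filter fun i : ℕ => pt c e f i j = x).card ≤ 1 := by
    refine Finset.card_le_one.2 fun i hi i' hi' => ?_
    rw [Finset.mem_filter, Finset.mem_range] at hi hi'
    obtain ⟨⟨s, hs⟩, -⟩ := hF.pt_eq_iff.1 (hi.2.trans hi'.2.symm)
    have s0 : s = 0 := by
      have : s < 1 := by by_contra!; nlinarith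
      have : -1 < s := by by_contra!; nlinarith
      omega
    subst s0
    omega
  have : (((Finset.range ℓ).filter fun i : ℕ => pt c e f i j = x).card : ℝ) ≤ 1 := by
    exact_mod_cast hc1
  linarith

end Linked

section BoxChainConclusion

variable {L : ℕ} {β h : ℝ} {σ η ξ ζ : Config L} {c : Site L} {ℓ : ℕ} [NeZero L]

/-- Configurations linked with their image by the zero temperature dynamics. -/
def linkedSet (h : ℝ) (ℓ : ℕ) (c : Site L) : Set (Config L) :=
  {ξ | SupportedOn (sq ℓ c) ξ ∧ Linked ℓ c ξ (boxT h (sq ℓ c) ξ)}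

omit [NeZero L] in
lemma boxT_fullC (hh : 0 < h) (hℓ : 2 ≤ ℓ) :
    boxT h (sq ℓ c) (fullC (sq ℓ c)) = fullC (sq ℓ c) := by
  have hF : IsFrame (east L) (north L) := Or.inl ⟨rfl, rfl⟩
  funext x
  by_cases hx : x ∈ sq ℓ c
  · have := hF.nnS_nonneg_of_mem_gbox (σ := fullC (sq ℓ c)) (c := c) hℓ hℓ
      (fun y hy => by simp only [fullC, decide_eq_true_eq]; exact hy) hx
    simp only [boxT, fullC, hx, true_and, decide_true, decide_eq_true_eq]
    linarith
  · simp [boxT, fullC, hx]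

omit [NeZero L] in
lemma linked_fullC (hℓ : ℓ + 2 ≤ L) : Linked ℓ c (fullC (sq ℓ c)) (fullC (sq ℓ c)) := by
  intro e f hF j hj
  have : pt c e f (0 : ℕ) j ∈ sq ℓ c := by rw [hF.mem_sq hℓ] <;> omega
  exact ⟨⟨0, by omega, by simpa [zig, fullC] using this⟩,
    ⟨0, by omega, by simpa [zig, fullC] using this⟩⟩

omit [NeZero L] in
lemma fullC_mem_linkedSet (hh : 0 < h) (hℓ : 2 ≤ ℓ) (hL : ℓ + 2 ≤ L) :
    fullC (sq ℓ c) ∈ linkedSet h ℓ c :=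
  ⟨supportedOn_fullC _, by rw [boxT_fullC hh hℓ]; exact linked_fullC hL⟩

lemma boxMu_mul_eq_zero {Q : Set (Site L)} (hη : ¬ SupportedOn Q η) :
    boxMu β h Q σ * prodK (boxP β h Q) σ η = 0 := by
  rw [boxMu_mul, if_neg fun h' => hη h'.2]

lemma Linked.boxMu_mul_le (hl : Linked ℓ c σ η) (hβ : 0 ≤ β) (hh : 0 ≤ h) (hL : ℓ + 2 ≤ L)
    (hσ : SupportedOn (sq ℓ c) σ) (hη : SupportedOn (sq ℓ c) η) {d : ℝ}
    (hd : d ≤ deficit (sq ℓ c) σ η) :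
    boxMu β h (sq ℓ c) σ * prodK (boxP β h (sq ℓ c)) σ η ≤
      Real.exp (β * (pairW h (fullC (sq ℓ c)) (fullC (sq ℓ c)) - h * d)) := by
  rw [boxMu_mul, if_pos ⟨hσ, hη⟩]
  refine Real.exp_le_exp.2 (mul_le_mul_of_nonneg_left ?_ hβ)
  linarith [hl.pairW_le (h := h) hL hσ hη, mul_le_mul_of_nonneg_left hd hh]

lemma boxMu_mul_le_of_not_linked (hβ : 0 ≤ β) (hh : 0 ≤ h) (hL : ℓ + 2 ≤ L)
    (hσ : σ ∈ linkedSet h ℓ c) (hη : SupportedOn (sq ℓ c) η) (hl : ¬ Linked ℓ c σ η) :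
    boxMu β h (sq ℓ c) σ * prodK (boxP β h (sq ℓ c)) σ η ≤
      Real.exp (β * (pairW h (fullC (sq ℓ c)) (fullC (sq ℓ c)) - h * (2 * ((ℓ : ℝ) - 1)))) := by
  obtain ⟨m, hm, hlm, x, v, hx⟩ := exists_interpolation (P := Linked ℓ c σ) hσ.2 hl
  have hms : SupportedOn (sq ℓ c) m := fun y hy => by
    rcases hm y with h' | h' <;> rw [h']
    exacts [supportedOn_boxT _ _ y hy, hη y hy]
  refine le_trans (mul_le_mul_of_nonneg_left ?_ (boxMu_nonneg σ))
    (hlm.boxMu_mul_le hβ hh hL hσ.1 hms (le_deficit_of_not_linked hL hσ.1 hms hx))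
  refine Finset.prod_le_prod (fun y _ => isRule_boxP.nonneg σ y _) fun y _ => ?_
  rcases hm y with h' | h' <;> rw [h']
  exact boxP_le_boxT hβ σ y _

lemma boxMu_mul_le_of_exit (hβ : 0 ≤ β) (hh : 0 ≤ h) (hL : ℓ + 2 ≤ L)
    (hσ : σ ∈ linkedSet h ℓ c) (hη : η ∉ linkedSet h ℓ c) :
    boxMu β h (sq ℓ c) σ * prodK (boxP β h (sq ℓ c)) σ η ≤
      Real.exp (β * (pairW h (fullC (sq ℓ c)) (fullC (sq ℓ c)) - h * (2 * ((ℓ : ℝ) - 1)))) := by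
  by_cases hs : SupportedOn (sq ℓ c) η
  swap
  · rw [boxMu_mul_eq_zero hs]; positivity
  by_cases hl : Linked ℓ c σ η
  swap
  · exact boxMu_mul_le_of_not_linked hβ hh hL hσ hs hl
  obtain ⟨m, hm, hlm, x, v, hx⟩ := exists_interpolation (P := Linked ℓ c η) hl.symm
    fun h' => hη ⟨hs, h'⟩
  have hms : SupportedOn (sq ℓ c) m := fun y hy => by
    rcases hm y with h' | h' <;> rw [h']
    exacts [hσ.1 y hy, supportedOn_boxT _ _ y hy]
  rw [boxMu_reversible]
  refine le_trans (mul_le_mul_of_nonneg_left ?_ (boxMu_nonneg η))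
    (hlm.boxMu_mul_le hβ hh hL hs hms (le_deficit_of_not_linked hL hs hms hx))
  refine Finset.prod_le_prod (fun y _ => isRule_boxP.nonneg η y _) fun y _ => ?_
  rcases hm y with h' | h' <;> rw [h']
  exact boxP_le_boxT hβ η y _

lemma exp_le_boxMu_fullC :
    Real.exp (β * pairW h (fullC (sq ℓ c)) (fullC (sq ℓ c))) ≤
      boxMu β h (sq ℓ c) (fullC (sq ℓ c)) := by
  have h1 := boxMu_mul (β := β) (h := h) (Q := sq ℓ c) (fullC (sq ℓ c)) (fullC (sq ℓ c))
  rw [if_pos ⟨supportedOn_fullC _, supportedOn_fullC _⟩] at h1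
  rw [← h1]
  exact mul_le_of_le_one_right (boxMu_nonneg _) (isRule_boxP.isStoch.le_one _ _)

/-- The restricted dynamics takes a long time to break the links. -/
lemma one_sub_surv_box_le (hβ : 0 ≤ β) (hh : 0 < h) (hℓ : 2 ≤ ℓ) (hL : ℓ + 2 ≤ L) (n : ℕ) :
    1 - surv (prodK (boxP β h (sq ℓ c))) (linkedSet h ℓ c)ᶜ n (fullC (sq ℓ c)) ≤
      n * ((Fintype.card (Config L) : ℝ) ^ 2 * Real.exp (-(2 * β * h * ((ℓ : ℝ) - 1)))) := by
  have hmain := mul_one_sub_surv_compl_le (isRule_boxP (β := β) (h := h) (Q := sq ℓ c)).isStoch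
    (μ := boxMu β h (sq ℓ c)) boxMu_nonneg boxMu_stationary
    (fullC_mem_linkedSet (c := c) hh hℓ hL)
    (fun ξ hξ ζ hζ => boxMu_mul_le_of_exit hβ hh.le hL hξ hζ) (Real.exp_pos _).le n
  have h1 := exp_le_boxMu_fullC (β := β) (h := h) (ℓ := ℓ) (c := c)
  have h2 : 0 ≤ 1 - surv (prodK (boxP β h (sq ℓ c))) (linkedSet h ℓ c)ᶜ n (fullC (sq ℓ c)) :=
    sub_nonneg.2 (surv_le_one isRule_boxP.isStoch n _)
  have h3 := (mul_le_mul_of_nonneg_right h1 h2).trans hmain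
  have h4 : Real.exp (β * (pairW h (fullC (sq ℓ c)) (fullC (sq ℓ c)) - h * (2 * ((ℓ : ℝ) - 1)))) =
      Real.exp (β * pairW h (fullC (sq ℓ c)) (fullC (sq ℓ c))) *
        Real.exp (-(2 * β * h * ((ℓ : ℝ) - 1))) := by rw [← Real.exp_add]; ring_nf
  rw [h4] at h3
  refine le_of_mul_le_mul_left (h3.trans_eq ?_) (Real.exp_pos _)
  ring

/-- Before breaking the links, the restricted dynamics mostly stays at the full square. -/
lemma kop_box_ne_fullC_le (hβ : 0 ≤ β) (hh : 0 < h) (hL : ℓ + 2 ≤ L) (n : ℕ) :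
    kop (prodK (boxP β h (sq ℓ c))) ∅ (ind (linkedSet h ℓ c \ {fullC (sq ℓ c)})) n
        (fullC (sq ℓ c)) ≤
      (Fintype.card (Config L) : ℝ) ^ 2 * Real.exp (-(2 * β * h)) := by
  have hK : IsStoch (prodK (boxP β h (sq ℓ c))) := isRule_boxP.isStoch
  have hmain := mul_kop_empty_le hK (μ := boxMu β h (sq ℓ c)) boxMu_nonneg boxMu_stationary
    (f := ind (linkedSet h ℓ c \ {fullC (sq ℓ c)})) (ind_nonneg _) n (fullC (sq ℓ c))
  have hterm : ∀ ξ, boxMu β h (sq ℓ c) ξ * ind (linkedSet h ℓ c \ {fullC (sq ℓ c)}) ξ ≤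
      Fintype.card (Config L) *
        Real.exp (β * (pairW h (fullC (sq ℓ c)) (fullC (sq ℓ c)) - h * 2)) := fun ξ => by
    unfold ind
    split_ifs with hξ
    swap
    · rw [mul_zero]; positivity
    rw [mul_one, ← mul_one (boxMu β h (sq ℓ c) ξ), ← hK.sum_eq ξ, Finset.mul_sum]
    refine (Finset.sum_le_card_nsmul _ _
      (Real.exp (β * (pairW h (fullC (sq ℓ c)) (fullC (sq ℓ c)) - h * 2))) fun ζ _ => ?_).trans_eq
      (by rw [nsmul_eq_mul, Finset.card_univ])
    refine le_trans (mul_le_mul_of_nonneg_left ?_ (boxMu_nonneg ξ))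
      (hξ.1.2.boxMu_mul_le hβ hh.le hL hξ.1.1 (supportedOn_boxT _ _)
        (two_le_deficit hξ.1.1 (supportedOn_boxT _ _) hξ.2))
    exact Finset.prod_le_prod (fun y _ => isRule_boxP.nonneg ξ y _)
      fun y _ => boxP_le_boxT hβ ξ y _
  have h1 := exp_le_boxMu_fullC (β := β) (h := h) (ℓ := ℓ) (c := c)
  have h2 := kop_nonneg hK (D := ∅) (ind_nonneg (linkedSet h ℓ c \ {fullC (sq ℓ c)})) n
    (fullC (sq ℓ c))
  have h3 := ((mul_le_mul_of_nonneg_right h1 h2).trans hmain).trans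
    (Finset.sum_le_card_nsmul _ _ _ fun ξ _ => hterm ξ)
  have h4 : Real.exp (β * (pairW h (fullC (sq ℓ c)) (fullC (sq ℓ c)) - h * 2)) =
      Real.exp (β * pairW h (fullC (sq ℓ c)) (fullC (sq ℓ c))) *
        Real.exp (-(2 * β * h)) := by rw [← Real.exp_add]; ring_nf
  rw [h4, nsmul_eq_mul, Finset.card_univ] at h3
  refine le_of_mul_le_mul_left (h3.trans_eq ?_) (Real.exp_pos _)
  ring

/-- Configurations without pluses of the square on one of its two sublattices. -/
def thinSet (ℓ : ℕ) (c : Site L) : Set (Config L) :=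
  {σ | ∃ C : Config L, IsChessCfg C ∧ ∀ x ∈ sq ℓ c, C x = true → σ x = false}

omit [NeZero L] in
lemma isLowerSet_thinSet : IsLowerSet (thinSet ℓ c) := by
  rintro σ σ' hσ ⟨C, hC, h'⟩
  refine ⟨C, hC, fun x hx hCx => ?_⟩
  have := hσ x
  rw [h' x hx hCx] at this
  exact le_bot_iff.1 this

/-- On the thin configurations the links are broken. -/
lemma thinSet_subset (hh : h < 2) (hLe : Even L) (hℓ : 2 ≤ ℓ) :
    thinSet ℓ c ⊆ (linkedSet h ℓ c)ᶜ := by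
  rintro σ ⟨C, hC, hσ⟩ ⟨hs, hl⟩
  have hF : IsFrame (east L) (north L) := Or.inl ⟨rfl, rfl⟩
  have hfalse : ∀ x, C x = true → σ x = false := fun x hx => by
    by_cases hxq : x ∈ sq ℓ c
    exacts [hσ x hxq hx, hs x hxq]
  have hT : ∀ x, C x = false → boxT h (sq ℓ c) σ x = false := fun x hx => by
    have h1 := hfalse _ ((hC.add hLe hF x).trans (by rw [hx]; rfl))
    have h2 := hfalse _ ((hC.sub hLe hF x).trans (by rw [hx]; rfl))
    have h3 := hfalse _ ((hC.add hLe hF.symm x).trans (by rw [hx]; rfl))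
    have h4 := hfalse _ ((hC.sub hLe hF.symm x).trans (by rw [hx]; rfl))
    have : ¬ 0 < nnS σ x + h := by
      rw [nnS, h1, h2, h3, h4, spin_false]
      linarith
    simp [boxT, this]
  have hrow : ∀ i : ℕ, C (pt c (east L) (north L) i 0) =
      if Even i then C (pt c (east L) (north L) 0 0) else !C (pt c (east L) (north L) 0 0) := by
    intro i
    induction i with
    | zero => simp
    | succ i ih =>
      rw [Nat.cast_succ, ← pt_add_left, hC.add hLe hF, ih]
      by_cases hi : Even i <;> simp [hi, Nat.even_add_one]
  obtain ⟨⟨i, -, h1⟩, ⟨k, -, h2⟩⟩ := hl _ _ hF 0 (by omega)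
  rw [Nat.cast_zero] at h1 h2
  have hi := hrow i
  have hk := hrow k
  unfold zig at h1 h2
  cases h0 : C (pt c (east L) (north L) 0 0)
  · rw [h0] at hk
    split_ifs at h2 hk with hke
    · rw [hT _ hk] at h2; exact Bool.false_ne_true h2
    · rw [hfalse _ hk] at h2; exact Bool.false_ne_true h2
  · rw [h0] at hi
    split_ifs at h1 hi with hie
    · rw [hfalse _ hi] at h1; exact Bool.false_ne_true h1
    · rw [hT _ hi] at h1; exact Bool.false_ne_true h1

omit [NeZero L] in
lemma chessSet_subset_thinSet : chessSet L ⊆ thinSet ℓ c := fun σ hσ =>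
  ⟨flipC σ, (isChessCfg_iff.2 hσ).flipC, fun x _ hx => by simpa [flipC] using hx⟩

/-- A configuration that is plus on a square takes a long time to become a chessboard. -/
lemma le_surv_chessSet (hβ : 0 ≤ β) (hh : 0 < h) (hh2 : h < 2) (hLe : Even L) (hℓ : 2 ≤ ℓ)
    (hL : ℓ + 2 ≤ L) (hσ : fullC (sq ℓ c) ≤ σ) (n : ℕ) :
    1 - n * ((Fintype.card (Config L) : ℝ) ^ 2 * Real.exp (-(2 * β * h * ((ℓ : ℝ) - 1)))) ≤
      surv (Pmat β h) (chessSet L) n σ := by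
  have h1 := one_sub_surv_box_le (c := c) hβ hh hℓ hL n
  have hK : IsStoch (prodK (boxP β h (sq ℓ c))) := isRule_boxP.isStoch
  have h2 : surv (prodK (boxP β h (sq ℓ c))) (linkedSet h ℓ c)ᶜ n (fullC (sq ℓ c)) ≤
      surv (prodK (boxP β h (sq ℓ c))) (thinSet ℓ c) n (fullC (sq ℓ c)) :=
    kop_anti_set hK (thinSet_subset hh2 hLe hℓ) (fun _ => zero_le_one) n _
  have h3 : surv (prodK (boxP β h (sq ℓ c))) (thinSet ℓ c) n (fullC (sq ℓ c)) ≤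
      surv (Pmat β h) (thinSet ℓ c) n σ :=
    kop_prodK_le (isRule_flipP β h) isRule_boxP (fun σ' σ hσ x => boxP_true_le hβ hσ x)
      (fun σ' σ hσ x => flipP_true_mono hβ hσ x) isLowerSet_thinSet monotone_const
      (fun _ => zero_le_one) n hσ
  have h4 : surv (Pmat β h) (thinSet ℓ c) n σ ≤ surv (Pmat β h) (chessSet L) n σ :=
    kop_anti_set (isStoch_Pmat β h) chessSet_subset_thinSet (fun _ => zero_le_one) n _
  linarith

/-- A configuration that is plus on a square is still plus on it after some time. -/
lemma kop_not_filled_le (hβ : 0 ≤ β) (hh : 0 < h) (hℓ : 2 ≤ ℓ)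
    (hL : ℓ + 2 ≤ L) (hσ : ∀ x ∈ sq ℓ c, σ x = true) (n : ℕ) :
    kop (Pmat β h) ∅ (ind {η | ∀ x ∈ sq ℓ c, η x = true}ᶜ) n σ ≤
      n * ((Fintype.card (Config L) : ℝ) ^ 2 * Real.exp (-(2 * β * h * ((ℓ : ℝ) - 1)))) +
      (Fintype.card (Config L) : ℝ) ^ 2 * Real.exp (-(2 * β * h)) := by
  set F : Set (Config L) := {η | ∀ x ∈ sq ℓ c, η x = true} with hF
  have hP := isStoch_Pmat (L := L) β h
  have hK : IsStoch (prodK (boxP β h (sq ℓ c))) := isRule_boxP.isStoch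
  have hσ' : fullC (sq ℓ c) ≤ σ := fun x => by
    by_cases hx : x ∈ sq ℓ c
    · rw [hσ x hx]; exact Bool.le_true _
    · simp [fullC, hx]
  have hmono : Monotone (ind F) := fun η η' hη => by
    unfold ind
    split_ifs with h1 h2
    · exact le_rfl
    · exact absurd (fun x hx => top_le_iff.1 ((h1 x hx).symm.le.trans (hη x))) h2
    · exact zero_le_one
    · exact le_rfl
  have hcompl : ∀ {K : Config L → Config L → ℝ}, IsStoch K → ∀ ξ,
      kop K ∅ (ind F) n ξ + kop K ∅ (ind Fᶜ) n ξ = 1 := fun hK ξ => by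
    rw [← kop_add, show (fun η => ind F η + ind Fᶜ η) = fun _ => (1 : ℝ) from funext fun η => by
      unfold ind; by_cases h' : η ∈ F <;> simp [h'], kop_empty_one hK]
  have h1 : kop (prodK (boxP β h (sq ℓ c))) ∅ (ind F) n (fullC (sq ℓ c)) ≤
      kop (Pmat β h) ∅ (ind F) n σ :=
    kop_prodK_le (isRule_flipP β h) isRule_boxP (fun σ' σ hσ x => boxP_true_le hβ hσ x)
      (fun σ' σ hσ x => flipP_true_mono hβ hσ x) isLowerSet_empty hmono
      (ind_nonneg _) n hσ'
  have h2 := hcompl hP σ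
  have h3 := hcompl hK (fullC (sq ℓ c))
  have h4 : kop (prodK (boxP β h (sq ℓ c))) ∅ (ind Fᶜ) n (fullC (sq ℓ c)) ≤
      kop (prodK (boxP β h (sq ℓ c))) ∅ (ind (linkedSet h ℓ c)ᶜ) n (fullC (sq ℓ c)) +
      kop (prodK (boxP β h (sq ℓ c))) ∅ (ind (linkedSet h ℓ c \ {fullC (sq ℓ c)})) n
        (fullC (sq ℓ c)) := by
    rw [← kop_add]
    refine kop_mono hK (fun η => ?_) n _
    have h0 := ind_nonneg (linkedSet h ℓ c)ᶜ η
    have h0' := ind_nonneg (linkedSet h ℓ c \ {fullC (sq ℓ c)}) η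
    by_cases h6 : η ∈ F
    · rw [show ind Fᶜ η = 0 from if_neg fun h' => h' h6]
      linarith
    · rw [show ind Fᶜ η = 1 from if_pos h6]
      by_cases h5 : η ∈ linkedSet h ℓ c
      · have h7 : η ≠ fullC (sq ℓ c) := fun h' => h6 fun x hx => by
          rw [h']; simpa [fullC] using hx
        rw [show ind (linkedSet h ℓ c \ {fullC (sq ℓ c)}) η = 1 from if_pos ⟨h5, h7⟩]
        linarith
      · rw [show ind (linkedSet h ℓ c)ᶜ η = 1 from if_pos h5]
        linarith
  have h5 := kop_empty_compl_le hK (A := linkedSet h ℓ c) n (fullC (sq ℓ c))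
  have h6 := one_sub_surv_box_le (c := c) hβ hh hℓ hL n
  have h7 := kop_box_ne_fullC_le (c := c) hβ hh hL n
  linarith

end BoxChainConclusion

section Hitting

variable {L : ℕ} {β h : ℝ} {σ : Config L} {c e f : Site L} {a b ℓ : ℕ} [NeZero L]

lemma le_surv_confSet_compl (hL : Even L) (hF : IsFrame e f) (ha : a + 2 ≤ L) (hb : b + 2 ≤ L)
    (hβ : 0 ≤ β) (hh : 0 < h) (hσ : σ ∈ confSet (gbox c e f a b)) (n : ℕ) :
    1 - n * (Fintype.card (Site L) * (2 * Real.exp (-(2 * β * (2 - h))))) ≤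
      surv (Pmat β h) (confSet (gbox c e f a b))ᶜ n σ := by
  have h1 := le_surv_compl (isStoch_Pmat β h) (A := confSet (gbox c e f a b)) (by positivity)
    (fun ξ hξ => confSet_step_compl_le hL hF ha hb hβ hh hξ) n σ
  rwa [show ind (confSet (gbox c e f a b))ᶜ σ = 0 from if_neg fun h' => h' hσ, sub_zero] at h1

/-- A confined droplet takes a long time to invade the torus. -/
lemma le_surv_plusC (hL : Even L) (hF : IsFrame e f) (ha : a + 2 ≤ L) (hb : b + 2 ≤ L)
    (hβ : 0 ≤ β) (hh : 0 < h) (hσ : σ ∈ confSet (gbox c e f a b)) (n : ℕ) :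
    1 - n * (Fintype.card (Site L) * (2 * Real.exp (-(2 * β * (2 - h))))) ≤
      surv (Pmat β h) {plusC L} n σ :=
  (le_surv_confSet_compl hL hF ha hb hβ hh hσ n).trans
    (kop_anti_set (isStoch_Pmat β h)
      (Set.singleton_subset_iff.2 (plusC_notMem_confSet hL hF ha hb))
      (fun _ => zero_le_one) n σ)

lemma cst_pow_mul_le_one {x : ℝ} (n : ℕ) (h0 : 0 ≤ x) (hx : x ≤ 1) : cst L ^ n * x ≤ 1 :=
  mul_le_one₀ (pow_le_one₀ (cst_pos L).le (cst_le_one L)) h0 hx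

/-- A confined droplet shrinks, one line at a time. -/
lemma surv_chessSet_le (hL : Even L) (hF : IsFrame e f) (ha : a + 2 ≤ L) (ha1 : 1 ≤ a)
    (hβ : 0 ≤ β) (hh : 0 < h) (hh2 : h < 2) (k : ℕ) (hb : b + 2 ≤ L)
    (hσ : σ ∈ confSet (gbox c e f a b)) :
    surv (Pmat β h) (chessSet L) (b * (k * (a + 1))) σ ≤
      b * ((1 - cst L ^ (a + 1) * Real.exp (-(2 * β * h)) ^ (a - 1)) ^ k +
        ((k * (a + 1) : ℕ) : ℝ) *
          (Fintype.card (Site L) * (2 * Real.exp (-(2 * β * (2 - h)))))) := by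
  have hP := isStoch_Pmat (L := L) β h
  have hx0 : 0 ≤ Real.exp (-(2 * β * h)) ^ (a - 1) := by positivity
  have hx1 : Real.exp (-(2 * β * h)) ^ (a - 1) ≤ 1 :=
    pow_le_one₀ (Real.exp_pos _).le (Real.exp_le_one_iff.2 (by nlinarith))
  have hp1 := cst_pow_mul_le_one (L := L) (a + 1) hx0 hx1
  have hp0 : 0 ≤ cst L ^ (a + 1) * Real.exp (-(2 * β * h)) ^ (a - 1) :=
    mul_nonneg (pow_nonneg (cst_pos L).le _) hx0
  induction b generalizing σ with
  | zero => rw [surv_of_mem _ (confSet_gbox_zero hσ)]; simp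
  | succ b ih =>
    have hchain := surv_chain hP (D := chessSet L) (B := confSet (gbox c e f a b))
      (t := b * (k * (a + 1)))
      (mul_nonneg b.cast_nonneg (add_nonneg (pow_nonneg (sub_nonneg.2 hp1) k) (by positivity)))
      (fun ξ hξ => ih (by omega) hξ) (k * (a + 1)) σ
    have hatt := surv_attempts hP (D := confSet (gbox c e f a b)) hp0 hp1
      (A := confSet (gbox c e f a (b + 1)))
      (fun ξ hξ => surv_shrink hL hF ha ha1 (by omega) hβ hh hh2 hξ) σ k
      (δ := ((k * (a + 1) : ℕ) : ℝ) *
          (Fintype.card (Site L) * (2 * Real.exp (-(2 * β * (2 - h))))))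
      (fun n hn => (kop_empty_compl_le hP n σ).trans (by
        have h1 := le_surv_confSet_compl hL hF ha hb hβ hh hσ n
        have h2 : (n : ℝ) ≤ ((k * (a + 1) : ℕ) : ℝ) := by exact_mod_cast hn
        have h3 := mul_le_mul_of_nonneg_right h2 (show 0 ≤ Fintype.card (Site L) *
          (2 * Real.exp (-(2 * β * (2 - h)))) by positivity)
        linarith))
    rw [show (b + 1) * (k * (a + 1)) = k * (a + 1) + b * (k * (a + 1)) by ring]
    refine (hchain.trans (add_le_add_left hatt _)).trans_eq ?_
    rw [Nat.cast_succ]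
    ring

lemma kop_aboveChess_compl_le (hL : Even L) (hβ : 0 ≤ β) (hσ : σ ∈ aboveChess L) (n : ℕ) :
    kop (Pmat β h) ∅ (ind (aboveChess L)ᶜ) n σ ≤
      n * (Fintype.card (Site L) * (2 * Real.exp (-(2 * β * (4 + h))))) := by
  have h1 := le_surv_compl (isStoch_Pmat β h) (A := aboveChess L) (by positivity)
    (fun ξ hξ => aboveChess_step_compl_le hL hβ hξ) n σ
  rw [show ind (aboveChess L)ᶜ σ = 0 from if_neg fun h' => h' hσ, sub_zero] at h1
  linarith [kop_empty_compl_le (isStoch_Pmat (L := L) β h) (A := aboveChess L) n σ]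

lemma kop_finsetSum {α ι : Type*} [Fintype α] {K : α → α → ℝ} (hK : IsStoch K) (s : Finset ι)
    (g : ι → α → ℝ) (n : ℕ) (σ : α) :
    kop K ∅ (fun η => ∑ i ∈ s, g i η) n σ = ∑ i ∈ s, kop K ∅ (g i) n σ := by
  induction s using Finset.induction_on with
  | empty => simpa using kop_empty_one hK 0 n σ
  | insert i s hi ih =>
    rw [Finset.sum_insert hi, ← ih, ← kop_add]
    exact congrArg (fun g => kop K ∅ g n σ) (funext fun η => Finset.sum_insert hi)

/-- The pluses filling squares above a chessboard are stable for a long time. -/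
lemma kop_filledSet_compl_le (hL : Even L) (hβ : 0 ≤ β) (hh : 0 < h) (hℓ : 2 ≤ ℓ)
    (hℓL : ℓ + 2 ≤ L) {B : Finset (Site L)} (hσ : σ ∈ filledSet ℓ B) (n : ℕ) :
    kop (Pmat β h) ∅ (ind (filledSet ℓ B)ᶜ) n σ ≤
      n * (Fintype.card (Site L) * (2 * Real.exp (-(2 * β * (4 + h))))) +
      Fintype.card (Site L) *
        (n * ((Fintype.card (Config L) : ℝ) ^ 2 * Real.exp (-(2 * β * h * ((ℓ : ℝ) - 1)))) +
          (Fintype.card (Config L) : ℝ) ^ 2 * Real.exp (-(2 * β * h))) := by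
  have hP := isStoch_Pmat (L := L) β h
  obtain ⟨C, hC, hCσ, hB⟩ := hσ
  have hind : ∀ η, ind (filledSet ℓ B)ᶜ η ≤
      ind (aboveChess L)ᶜ η + ∑ y ∈ B, ind {η | ∀ x ∈ sq ℓ y, η x = true}ᶜ η := fun η => by
    have h1 := ind_nonneg (aboveChess L)ᶜ η
    have h2 : ∀ y ∈ B, 0 ≤ ind {η : Config L | ∀ x ∈ sq ℓ y, η x = true}ᶜ η :=
      fun y _ => ind_nonneg _ η
    by_cases hη : η ∈ filledSet ℓ B
    · rw [show ind (filledSet ℓ B)ᶜ η = 0 from if_neg fun h' => h' hη]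
      exact add_nonneg h1 (Finset.sum_nonneg h2)
    rw [show ind (filledSet ℓ B)ᶜ η = 1 from if_pos hη]
    by_cases hc : η ∈ aboveChess L
    · obtain ⟨y, hy, hyη⟩ : ∃ y ∈ B, ¬ ∀ x ∈ sq ℓ y, η x = true := by
        by_contra! hne
        obtain ⟨C, hC, hCη⟩ := hc
        exact hη ⟨C, hC, hCη, hne⟩
      have h3 := Finset.single_le_sum h2 hy
      rw [show ind {η : Config L | ∀ x ∈ sq ℓ y, η x = true}ᶜ η = 1 from if_pos hyη] at h3
      linarith
    · rw [show ind (aboveChess L)ᶜ η = 1 from if_pos hc]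
      linarith [Finset.sum_nonneg h2]
  refine (kop_mono hP hind n σ).trans ?_
  rw [kop_add, kop_finsetSum hP]
  refine add_le_add (kop_aboveChess_compl_le hL hβ ⟨C, hC, hCσ⟩ n) ?_
  refine (Finset.sum_le_card_nsmul _ _ _ fun y hy =>
    kop_not_filled_le hβ hh hℓ hℓL (hB y hy) n).trans ?_
  rw [nsmul_eq_mul]
  exact mul_le_mul_of_nonneg_right (by exact_mod_cast Finset.card_le_univ B) (by positivity)

/-- A supercritical droplet grows, one square at a time. -/
lemma surv_plusC_le (hL : Even L) (hβ : 0 ≤ β) (hh : 0 < h) (hh2 : h < 2) (hℓ : 2 ≤ ℓ)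
    (hℓL : ℓ + 2 ≤ L) (k r : ℕ) {B : Finset (Site L)} (hB : B.Nonempty) (hr : Bᶜ.card = r)
    (hσ : σ ∈ filledSet ℓ B) :
    surv (Pmat β h) {plusC L} (r * (k * (ℓ + 1))) σ ≤
      r * ((1 - cst L ^ (ℓ + 1) * Real.exp (-(2 * β * (2 - h)))) ^ k +
        (((k * (ℓ + 1) : ℕ) : ℝ) *
            (Fintype.card (Site L) * (2 * Real.exp (-(2 * β * (4 + h))))) +
          Fintype.card (Site L) * (((k * (ℓ + 1) : ℕ) : ℝ) *
            ((Fintype.card (Config L) : ℝ) ^ 2 * Real.exp (-(2 * β * h * ((ℓ : ℝ) - 1)))) +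
          (Fintype.card (Config L) : ℝ) ^ 2 * Real.exp (-(2 * β * h))))) := by
  have hP := isStoch_Pmat (L := L) β h
  have hp1 := cst_pow_mul_le_one (L := L) (ℓ + 1) (Real.exp_pos (-(2 * β * (2 - h)))).le
    (Real.exp_le_one_iff.2 (by nlinarith))
  have hp0 : 0 ≤ cst L ^ (ℓ + 1) * Real.exp (-(2 * β * (2 - h))) :=
    mul_nonneg (pow_nonneg (cst_pos L).le _) (Real.exp_pos _).le
  induction r generalizing σ B with
  | zero =>
    have : B = Finset.univ := by simpa using hr
    rw [this] at hσ
    rw [surv_of_mem _ (filledSet_univ hℓ hσ)]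
    simp
  | succ r ih =>
    obtain ⟨c, hc, e, f, hF, hce⟩ := exists_add_notMem hB fun h' => by simp [h'] at hr
    have hchain := surv_chain hP (D := {plusC L}) (B := filledSet ℓ (insert (c + e) B))
      (t := r * (k * (ℓ + 1)))
      (mul_nonneg r.cast_nonneg (add_nonneg (pow_nonneg (sub_nonneg.2 hp1) k) (by positivity)))
      (fun ξ hξ => ih (Finset.insert_nonempty _ _) (by
        rw [Finset.card_compl] at hr ⊢
        rw [Finset.card_insert_of_notMem hce]
        omega) hξ) (k * (ℓ + 1)) σ
    have hatt := surv_attempts hP (D := filledSet ℓ (insert (c + e) B)) hp0 hp1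
      (A := filledSet ℓ B)
      (fun ξ hξ => surv_grow hL hF hℓ hβ hh hh2 hc hξ) σ k
      (δ := ((k * (ℓ + 1) : ℕ) : ℝ) *
            (Fintype.card (Site L) * (2 * Real.exp (-(2 * β * (4 + h))))) +
          Fintype.card (Site L) * (((k * (ℓ + 1) : ℕ) : ℝ) *
            ((Fintype.card (Config L) : ℝ) ^ 2 * Real.exp (-(2 * β * h * ((ℓ : ℝ) - 1)))) +
          (Fintype.card (Config L) : ℝ) ^ 2 * Real.exp (-(2 * β * h))))
      (fun n hn => (kop_filledSet_compl_le hL hβ hh hℓ hℓL hσ n).trans (by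
        have h2 : (n : ℝ) ≤ ((k * (ℓ + 1) : ℕ) : ℝ) := by exact_mod_cast hn
        gcongr))
    rw [show (r + 1) * (k * (ℓ + 1)) = k * (ℓ + 1) + r * (k * (ℓ + 1)) by ring]
    refine (hchain.trans (add_le_add_left hatt _)).trans_eq ?_
    rw [Nat.cast_succ]
    ring

end Hitting

section Asymptotics

lemma tendsto_exp_mul_atTop {u : ℝ} (hu : 0 < u) :
    Tendsto (fun β : ℝ => Real.exp (β * u)) atTop atTop :=
  Real.tendsto_exp_atTop.comp (tendsto_id.atTop_mul_const hu)

lemma tendsto_exp_mul_zero {u : ℝ} (hu : u < 0) :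
    Tendsto (fun β : ℝ => Real.exp (β * u)) atTop (nhds 0) :=
  Real.tendsto_exp_atBot.comp (tendsto_id.atTop_mul_const_of_neg hu)

/-- Repeated attempts, with success probability `C * exp (-(β * a))`. -/
lemma tendsto_attempts {C a ε : ℝ} (hC : 0 < C) (hC1 : C ≤ 1) (ha : 0 ≤ a) (hε : 0 < ε) :
    Tendsto (fun β : ℝ => (1 - C * Real.exp (-(β * a))) ^ ⌊Real.exp (β * (a + ε))⌋₊)
      atTop (nhds 0) := by
  have hlim : Tendsto (fun β : ℝ => Real.exp (-(C * Real.exp (β * ε) - C))) atTop (nhds 0) :=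
    Real.tendsto_exp_neg_atTop_nhds_zero.comp
      (tendsto_atTop_add_const_right _ (-C) ((tendsto_exp_mul_atTop hε).const_mul_atTop hC))
  have hp1 : ∀ β : ℝ, 0 ≤ β → C * Real.exp (-(β * a)) ≤ 1 := fun β hβ =>
    mul_le_one₀ hC1 (Real.exp_pos _).le (Real.exp_le_one_iff.2 (by nlinarith))
  refine tendsto_of_tendsto_of_tendsto_of_le_of_le' tendsto_const_nhds hlim ?_ ?_
  · filter_upwards [eventually_ge_atTop 0] with β hβ
    exact pow_nonneg (sub_nonneg.2 (hp1 β hβ)) _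
  · filter_upwards [eventually_ge_atTop 0] with β hβ
    refine (pow_le_pow_left₀ (sub_nonneg.2 (hp1 β hβ)) (Real.one_sub_le_exp_neg _) _).trans ?_
    rw [← Real.exp_nat_mul]
    refine Real.exp_le_exp.2 ?_
    have h1 := (Nat.lt_floor_add_one (Real.exp (β * (a + ε)))).le
    have h2 : Real.exp (-(β * a)) * Real.exp (β * (a + ε)) = Real.exp (β * ε) := by
      rw [← Real.exp_add]; ring_nf
    have h3 := mul_le_mul_of_nonneg_left h1 (mul_nonneg hC.le (Real.exp_pos (-(β * a))).le)
    have h4 := hp1 β hβ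
    have h5 : C * Real.exp (-(β * a)) ≤ C :=
      mul_le_of_le_one_right hC.le (Real.exp_le_one_iff.2 (by nlinarith))
    nlinarith

variable {L : ℕ} [NeZero L] {h : ℝ} {η : Config L} {D D' : Set (Config L)}

/-- The set `D` is reached before the time `exp (β * (a + ε))`. -/
def FastHit (h a : ℝ) (η : Config L) (D : Set (Config L)) : Prop :=
  ∀ ε : ℝ, 0 < ε → ∃ n : ℝ → ℕ, (∀ᶠ β in atTop, (n β : ℝ) < Real.exp (β * (a + ε))) ∧
    Tendsto (fun β => surv (Pmat β h) D (n β) η) atTop (nhds 0)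

/-- The set `D` is not reached before the time `exp (β * (a - ε))`. -/
def SlowHit (h a : ℝ) (η : Config L) (D : Set (Config L)) : Prop :=
  ∃ M : ℝ, ∀ β : ℝ, 0 ≤ β → ∀ n : ℕ,
    1 - n * (M * Real.exp (-(β * a))) ≤ surv (Pmat β h) D n η

lemma SlowHit.tendsto {a a' : ℝ} (hs : SlowHit h a' η D) (ha : a < a') {n : ℝ → ℕ}
    (hn : ∀ᶠ β in atTop, (n β : ℝ) ≤ Real.exp (β * a)) :
    Tendsto (fun β => surv (Pmat β h) D (n β) η) atTop (nhds 1) := by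
  obtain ⟨M, hM⟩ := hs
  have hlim : Tendsto (fun β : ℝ => 1 - |M| * Real.exp (β * (a - a'))) atTop (nhds 1) := by
    simpa using ((tendsto_exp_mul_zero (sub_neg.2 ha)).const_mul |M|).const_sub 1
  refine tendsto_of_tendsto_of_tendsto_of_le_of_le' hlim tendsto_const_nhds ?_
    (Eventually.of_forall fun β => surv_le_one (isStoch_Pmat β h) _ _)
  filter_upwards [hn, eventually_ge_atTop 0] with β hn hβ
  refine le_trans ?_ (hM β hβ (n β))
  have h1 : Real.exp (β * (a - a')) = Real.exp (β * a) * Real.exp (-(β * a')) := by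
    rw [← Real.exp_add]; ring_nf
  rw [h1]
  have h2 : (n β : ℝ) * (M * Real.exp (-(β * a'))) ≤ n β * (|M| * Real.exp (-(β * a'))) := by
    gcongr
    exact le_abs_self M
  have h3 : (n β : ℝ) * (|M| * Real.exp (-(β * a'))) ≤
      Real.exp (β * a) * (|M| * Real.exp (-(β * a'))) :=
    mul_le_mul_of_nonneg_right hn (by positivity)
  linarith

lemma fastHit_of_attempts {R N : ℕ} {C a a' a'' M : ℝ} (hC : 0 < C) (hC1 : C ≤ 1) (ha : 0 ≤ a)
    (ha' : a < a') (ha'' : 0 < a'')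
    (hsurv : ∀ β : ℝ, 0 ≤ β → ∀ k : ℕ, surv (Pmat β h) D (R * (k * N)) η ≤
      R * ((1 - C * Real.exp (-(β * a))) ^ k +
        (k * (M * Real.exp (-(β * a'))) + M * Real.exp (-(β * a''))))) :
    FastHit h a η D := by
  intro ε hε
  obtain ⟨δ, hδ, hδε, hδa⟩ : ∃ δ > 0, δ < ε ∧ δ < a' - a :=
    ⟨min ε (a' - a) / 2, by have := lt_min hε (sub_pos.2 ha'); linarith,
      by have := lt_min hε (sub_pos.2 ha'); linarith [min_le_left ε (a' - a)],
      by have := lt_min hε (sub_pos.2 ha'); linarith [min_le_right ε (a' - a)]⟩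
  refine ⟨fun β => R * (⌊Real.exp (β * (a + δ))⌋₊ * N), ?_, ?_⟩
  · filter_upwards [(tendsto_exp_mul_atTop (sub_pos.2 hδε)).eventually_gt_atTop ((R : ℝ) * N)]
      with β hβ
    have h1 : Real.exp (β * (a + ε)) = Real.exp (β * (a + δ)) * Real.exp (β * (ε - δ)) := by
      rw [← Real.exp_add]; ring_nf
    rw [h1]
    refine lt_of_le_of_lt ?_ (mul_lt_mul_of_pos_left hβ (Real.exp_pos _))
    have h2 := Nat.floor_le (Real.exp_pos (β * (a + δ))).le
    have h3 := mul_le_mul_of_nonneg_right h2 (show 0 ≤ (R : ℝ) * N by positivity)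
    push_cast
    linarith
  · have hk : Tendsto (fun β : ℝ => (⌊Real.exp (β * (a + δ))⌋₊ : ℝ) *
        (M * Real.exp (-(β * a')))) atTop (nhds 0) := by
      have hlim : Tendsto (fun β : ℝ => |M| * Real.exp (β * (a + δ - a'))) atTop (nhds 0) := by
        simpa using (tendsto_exp_mul_zero (show a + δ - a' < 0 by linarith)).const_mul |M|
      refine squeeze_zero_norm (fun β => ?_) hlim
      have h1 : Real.exp (β * (a + δ - a')) = Real.exp (β * (a + δ)) * Real.exp (-(β * a')) := by
        rw [← Real.exp_add]; ring_nf
      rw [h1, norm_mul, norm_mul, Real.norm_natCast, Real.norm_eq_abs, Real.norm_eq_abs,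
        Real.abs_exp]
      have h2 := mul_le_mul_of_nonneg_right (Nat.floor_le (Real.exp_pos (β * (a + δ))).le)
        (show 0 ≤ |M| * Real.exp (-(β * a')) by positivity)
      linarith
    have hM : Tendsto (fun β : ℝ => M * Real.exp (-(β * a''))) atTop (nhds 0) := by
      simpa using (tendsto_exp_mul_zero (neg_lt_zero.2 ha'')).const_mul M
    have hlim := ((tendsto_attempts hC hC1 ha hδ).add (hk.add hM)).const_mul (R : ℝ)
    simp only [add_zero, mul_zero] at hlim
    refine tendsto_of_tendsto_of_tendsto_of_le_of_le' tendsto_const_nhds hlim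
      (Eventually.of_forall fun β => surv_nonneg (isStoch_Pmat β h) _ _) ?_
    filter_upwards [eventually_ge_atTop 0] with β hβ
    exact hsurv β hβ _

/-- If `D` is reached at times of order `exp (β * a)`, and `D'` later, then `D` is reached first. -/
lemma FastHit.tendsto_probHitBefore {a a' : ℝ} (hf : FastHit h a η D) (hs : SlowHit h a' η D')
    (ha : a < a') : Tendsto (fun β => probHitBefore β h η D D') atTop (nhds 1) := by
  obtain ⟨n, hn, hlim⟩ := hf ((a' - a) / 2) (by linarith)
  have hlim' := (hs.tendsto (show a + (a' - a) / 2 < a' by linarith)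
    (hn.mono fun β hβ => hβ.le)).sub hlim
  rw [sub_zero] at hlim'
  exact tendsto_of_tendsto_of_tendsto_of_le_of_le hlim' tendsto_const_nhds
    (fun β => le_probHitBefore (isStoch_Pmat β h) η D D' (n β))
    fun β => probHitBefore_le_one (isStoch_Pmat β h) η D D'

lemma FastHit.tendsto_probTauIn {a ε : ℝ} (hf : FastHit h a η D) (hs : SlowHit h a η D)
    (hε : 0 < ε) : Tendsto (fun β => probTauIn β h η D
      (Set.Ioo (Real.exp (β * (a - ε))) (Real.exp (β * (a + ε))))) atTop (nhds 1) := by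
  obtain ⟨n, hn, hlim⟩ := hf ε hε
  have hlim' := (hs.tendsto (n := fun β => ⌊Real.exp (β * (a - ε))⌋₊)
    (show a - ε < a by linarith)
    (Eventually.of_forall fun β => Nat.floor_le (Real.exp_pos _).le)).sub hlim
  rw [sub_zero] at hlim'
  refine tendsto_of_tendsto_of_tendsto_of_le_of_le' hlim' tendsto_const_nhds ?_
    (Eventually.of_forall fun β => probTauIn_le_one (isStoch_Pmat β h) η D _)
  filter_upwards [hn] with β hβ
  refine le_probTauIn (isStoch_Pmat β h) η D _ _ (n β) fun k hk hkn => ⟨?_, ?_⟩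
  · exact (Nat.floor_lt (Real.exp_pos _).le).1 hk
  · exact lt_of_le_of_lt (by exact_mod_cast hkn) hβ

end Asymptotics

section Droplet

variable {L : ℕ} {h : ℝ} {C : Config L} {c e f : Site L} {ℓ m : ℕ}

lemma exists_frame_rect (c : Site L) (a b : ℕ) :
    ∃ e f, IsFrame e f ∧ rect c a b = gbox c e f (min a b) (max a b) := by
  rcases le_total a b with hab | hab
  · exact ⟨_, _, Or.inl ⟨rfl, rfl⟩, by rw [min_eq_left hab, max_eq_right hab, rect_eq_gbox]⟩
  · exact ⟨_, _, Or.inr ⟨rfl, rfl⟩, by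
      rw [min_eq_right hab, max_eq_left hab, rect_eq_gbox, gbox_symm]⟩

variable [NeZero L] {η : Config L}

lemma fastHit_chessSet (hL : Even L) (hF : IsFrame e f) (hℓ : 2 ≤ ℓ) (hℓL : ℓ + 2 ≤ L)
    (hmL : m + 2 ≤ L) (hh : 0 < h) (hh2 : h < 2) (hsub : h * ℓ < 2)
    (hη : η ∈ confSet (gbox c e f ℓ m)) :
    FastHit h (2 * h * ((ℓ : ℝ) - 1)) η (chessSet L) := by
  have hℓ' : (1 : ℝ) ≤ ℓ := by exact_mod_cast (show 1 ≤ ℓ by omega)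
  refine fastHit_of_attempts (R := m) (N := ℓ + 1) (C := cst L ^ (ℓ + 1))
    (a' := 2 * (2 - h)) (a'' := 1) (M := (ℓ + 1) * (Fintype.card (Site L) * 2))
    (pow_pos (cst_pos L) _) (pow_le_one₀ (cst_pos L).le (cst_le_one L))
    (mul_nonneg (by positivity) (by linarith)) (by nlinarith) one_pos fun β hβ k => ?_
  refine (surv_chessSet_le hL hF hℓL (by omega) hβ hh hh2 k hmL hη).trans
    (mul_le_mul_of_nonneg_left ?_ m.cast_nonneg)
  have h1 : Real.exp (-(2 * β * h)) ^ (ℓ - 1) = Real.exp (-(β * (2 * h * ((ℓ : ℝ) - 1)))) := by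
    rw [← Real.exp_nat_mul, Nat.cast_sub (by omega), Nat.cast_one]
    ring_nf
  have h2 : Real.exp (-(2 * β * (2 - h))) = Real.exp (-(β * (2 * (2 - h)))) := by ring_nf
  rw [h1, h2]
  have h3 : (0 : ℝ) ≤ (ℓ + 1) * (Fintype.card (Site L) * 2) * Real.exp (-(β * 1)) := by positivity
  push_cast
  linarith

lemma slowHit_plusC (hL : Even L) (hF : IsFrame e f) (hℓL : ℓ + 2 ≤ L)
    (hmL : m + 2 ≤ L) (hh : 0 < h) (hη : η ∈ confSet (gbox c e f ℓ m)) :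
    SlowHit h (2 * (2 - h)) η {plusC L} := by
  refine ⟨Fintype.card (Site L) * 2, fun β hβ n => le_trans (le_of_eq ?_)
    (le_surv_plusC hL hF hℓL hmL hβ hh hη n)⟩
  ring_nf

lemma slowHit_chessSet (hL : Even L) (hℓ : 2 ≤ ℓ) (hℓL : ℓ + 2 ≤ L) (hh : 0 < h) (hh2 : h < 2)
    (hη : ∀ x ∈ sq ℓ c, η x = true) :
    SlowHit h (2 * h * ((ℓ : ℝ) - 1)) η (chessSet L) := by
  have hη' : fullC (sq ℓ c) ≤ η := fun x => by
    by_cases hx : x ∈ sq ℓ c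
    · rw [hη x hx]; exact Bool.le_true _
    · simp [fullC, hx]
  refine ⟨(Fintype.card (Config L) : ℝ) ^ 2, fun β hβ n => le_trans (le_of_eq ?_)
    (le_surv_chessSet hβ hh hh2 hL hℓ hℓL hη' n)⟩
  ring_nf

lemma fastHit_plusC (hL : Even L) (hℓ : 2 ≤ ℓ) (hℓL : ℓ + 2 ≤ L) (hh : 0 < h) (hh2 : h < 2)
    (hsup : 2 < h * ℓ) (hη : η ∈ filledSet ℓ {c}) :
    FastHit h (2 * (2 - h)) η {plusC L} := by
  set a' := min (2 * (4 + h)) (2 * h * ((ℓ : ℝ) - 1)) with ha'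
  set S : ℝ := (Fintype.card (Site L) : ℝ)
  set Q : ℝ := (Fintype.card (Config L) : ℝ) ^ 2
  have hS : 0 ≤ S := Nat.cast_nonneg _
  have hQ : 0 ≤ Q := by positivity
  refine fastHit_of_attempts (R := ({c}ᶜ : Finset (Site L)).card) (N := ℓ + 1)
    (C := cst L ^ (ℓ + 1)) (a' := a') (a'' := 2 * h) (M := (ℓ + 1) * (S * 2) + (ℓ + 1) * (S * Q))
    (pow_pos (cst_pos L) _) (pow_le_one₀ (cst_pos L).le (cst_le_one L))
    (by linarith) (lt_min (by linarith) (by nlinarith)) (by linarith) fun β hβ k => ?_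
  refine (surv_plusC_le hL hβ hh hh2 hℓ hℓL k _ (Finset.singleton_nonempty c) rfl hη).trans
    (mul_le_mul_of_nonneg_left ?_ (Nat.cast_nonneg _))
  have h1 : Real.exp (-(2 * β * (2 - h))) = Real.exp (-(β * (2 * (2 - h)))) := by ring_nf
  have h2 : Real.exp (-(2 * β * h)) = Real.exp (-(β * (2 * h))) := by ring_nf
  have h3 : Real.exp (-(2 * β * (4 + h))) ≤ Real.exp (-(β * a')) :=
    Real.exp_le_exp.2 (by
      have := mul_le_mul_of_nonneg_left (min_le_left (2 * (4 + h)) (2 * h * ((ℓ : ℝ) - 1))) hβ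
      linarith)
  have h4 : Real.exp (-(2 * β * h * ((ℓ : ℝ) - 1))) ≤ Real.exp (-(β * a')) :=
    Real.exp_le_exp.2 (by
      have := mul_le_mul_of_nonneg_left (min_le_right (2 * (4 + h)) (2 * h * ((ℓ : ℝ) - 1))) hβ
      linarith)
  rw [h1, h2, add_le_add_iff_left]
  calc _ ≤ ((k * (ℓ + 1) : ℕ) : ℝ) * (S * (2 * Real.exp (-(β * a')))) +
      S * (((k * (ℓ + 1) : ℕ) : ℝ) * (Q * Real.exp (-(β * a'))) +
        Q * Real.exp (-(β * (2 * h)))) := by gcongr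
    _ = (k : ℝ) * (((ℓ + 1) * (S * 2) + (ℓ + 1) * (S * Q)) * Real.exp (-(β * a'))) +
      S * Q * Real.exp (-(β * (2 * h))) := by push_cast; ring
    _ ≤ _ := by
      refine add_le_add_right (mul_le_mul_of_nonneg_right ?_ (Real.exp_pos _).le) _
      have h5 : 0 ≤ ((ℓ : ℝ) + 1) * (S * 2) := by positivity
      have h6 : 0 ≤ (ℓ : ℝ) * (S * Q) := by positivity
      linarith

omit [NeZero L] in
lemma mul_lt_two_of_lt_lam (hh : 0 < h) (hz : ∀ z : ℤ, (z : ℝ) ≠ 2 / h) (hℓ : ℓ < lam h) :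
    h * ℓ < 2 := by
  have h1 : (ℓ : ℝ) ≤ 2 / h := (Nat.le_floor_iff (by positivity)).1 (Nat.lt_succ_iff.1 hℓ)
  have h2 : (ℓ : ℝ) < 2 / h := lt_of_le_of_ne h1 (by exact_mod_cast hz ℓ)
  rwa [lt_div_iff₀ hh, mul_comm] at h2

omit [NeZero L] in
lemma two_lt_mul_of_lam_le (hh : 0 < h) (hℓ : lam h ≤ ℓ) : 2 < h * ℓ := by
  have h1 : 2 / h < ℓ := (Nat.floor_lt (by positivity)).1 hℓ
  rwa [div_lt_iff₀ hh, mul_comm] at h1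

end Droplet

/-- Proposition 3.5: subcritical/supercritical behaviour of a
single rectangular droplet of `+1` in a sea of chessboard `C`. -/
theorem single_plus_droplet_in_chess_sea :
    ∃ h₀ : ℝ, 0 < h₀ ∧ h₀ ≤ 2 ∧
    ∀ h : ℝ, 0 < h → h < h₀ → (∀ z : ℤ, (z : ℝ) ≠ 2 / h) →
    ∃ L₀ : ℕ, ∀ (L : ℕ) [NeZero L], Even L → L₀ ≤ L →
      ∀ C : Config L, IsChessCfg C →
      ∀ (c : Site L) (a b : ℕ), 2 ≤ min a b → max a b ≤ L - 2 →
      ∀ η : Config L, η = rectCfg C (plusC L) c a b →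
      ∀ ℓ : ℕ, ℓ = min a b →
        (ℓ < lam h →
          Tendsto (fun β : ℝ => probHitBefore β h η (chessSet L) {plusC L})
            atTop (nhds 1) ∧
          ∀ ε : ℝ, 0 < ε →
            Tendsto (fun β : ℝ => probTauIn β h η (chessSet L)
                (Set.Ioo (Real.exp (2 * β * h * ((ℓ : ℝ) - 1) - β * ε))
                  (Real.exp (2 * β * h * ((ℓ : ℝ) - 1) + β * ε))))
              atTop (nhds 1)) ∧
        (lam h ≤ ℓ →
          Tendsto (fun β : ℝ => probHitBefore β h η {plusC L} (chessSet L))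
            atTop (nhds 1) ∧
          ∀ ε : ℝ, 0 < ε →
            Tendsto (fun β : ℝ => probTauIn β h η {plusC L}
                (Set.Ioo (Real.exp (2 * β * (2 - h) - β * ε))
                  (Real.exp (2 * β * (2 - h) + β * ε))))
              atTop (nhds 1)) := by
  refine ⟨2, two_pos, le_rfl, fun h hh hh2 hz => ⟨0, ?_⟩⟩
  intro L _ hL _ C hC c a b hmin hmax η hη ℓ hℓ
  obtain ⟨e, f, hF, hrect⟩ := exists_frame_rect c a b
  rw [← hℓ] at hmin hrect
  have hm : ℓ ≤ max a b := hℓ ▸ min_le_max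
  have hmL : max a b + 2 ≤ L := by omega
  have hℓL : ℓ + 2 ≤ L := by omega
  have hin : ∀ x ∈ gbox c e f ℓ (max a b), η x = true := fun x hx => by
    rw [hη, rectCfg, hrect, if_pos hx]; rfl
  have hout : ∀ x ∉ gbox c e f ℓ (max a b), η x = C x := fun x hx => by
    rw [hη, rectCfg, hrect, if_neg hx]
  have hfill : ∀ x ∈ sq ℓ c, η x = true := fun x hx => by
    rw [sq, ← hF.gbox_square] at hx
    exact hin x (gbox_mono le_rfl hm hx)
  have hplus : ∀ x, C x = true → η x = true := fun x hx => by
    by_cases hxr : x ∈ gbox c e f ℓ (max a b)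
    exacts [hin x hxr, (hout x hxr).trans hx]
  have hconf : η ∈ confSet (gbox c e f ℓ (max a b)) :=
    ⟨C, hC, hplus, fun x hx hCx => (hout x hx).trans hCx⟩
  have hfilled : η ∈ filledSet ℓ {c} :=
    ⟨C, hC, hplus, fun y hy => by rw [Finset.mem_singleton.1 hy]; exact hfill⟩
  have hslow := slowHit_chessSet hL hmin hℓL hh hh2 hfill
  have hslow' := slowHit_plusC hL hF hℓL hmL hh hconf
  refine ⟨fun hlt => ?_, fun hle => ?_⟩
  · have hsub := mul_lt_two_of_lt_lam hh hz hlt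
    have hfast := fastHit_chessSet hL hF hmin hℓL hmL hh hh2 hsub hconf
    refine ⟨hfast.tendsto_probHitBefore hslow' (by nlinarith), fun ε hε => ?_⟩
    convert hfast.tendsto_probTauIn hslow hε using 6 <;> ring
  · have hsup := two_lt_mul_of_lam_le hh hle
    have hfast := fastHit_plusC hL hmin hℓL hh hh2 hsup hfilled
    refine ⟨hfast.tendsto_probHitBefore hslow (by nlinarith), fun ε hε => ?_⟩
    convert hfast.tendsto_probTauIn hslow' hε using 6 <;> ring

end PCA
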